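/- For every β ≥ 0, the limit F(β) := lim_{L→∞} (1/L) log Z_{β,L} exists, the limit F^NE(β) := lim_{L→∞} (1/L) log Z^NE_{β,L} exists and is finite, and F(β) = F^NE(β). -/

import Mathlib

open Filter

/-! ## Paths on `ℤ²` encoded by direction sequences -/

/-- The four unit steps of `ℤ²`: right, left, up, down. -/
def dirs : Fin 4 → ℤ × ℤ := ![(1, 0), (-1, 0), (0, 1), (0, -1)]

/-- The list of steps (increments) of an `L`-step path encoded by a direction sequence. -/
def stepsOf {L : ℕ} (s : Fin L → Fin 4) : List (ℤ × ℤ) := (List.ofFn s).map dirs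

/-- The position `w_i` of the path after `i` steps; `w_0 = (0,0)`. -/
def pt (steps : List (ℤ × ℤ)) (i : ℕ) : ℤ × ℤ := (steps.take i).sum

/-- Self-avoiding: the sites `w_0, …, w_L` are pairwise distinct. -/
def IsSA (steps : List (ℤ × ℤ)) : Prop :=
  ∀ i ≤ steps.length, ∀ j ≤ steps.length, pt steps i = pt steps j → i = j

/-- Prudent: no step points towards a previously visited site, i.e. for every
`i < L`, every `k ≥ 1` and every `j ≤ i`, `w_i + k (w_{i+1} - w_i) ≠ w_j`. -/
def IsPrudent (steps : List (ℤ × ℤ)) : Prop :=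
  ∀ i < steps.length, ∀ k : ℕ, 1 ≤ k → ∀ j ≤ i,
    pt steps i + (k : ℤ) • steps.getD i (0, 0) ≠ pt steps j

/-- Twice the midpoint `u_{i+1}` of step number `i` (0-indexed): `w_i + w_{i+1}`. -/
def dmid (steps : List (ℤ × ℤ)) (i : ℕ) : ℤ × ℤ := pt steps i + pt steps (i + 1)

/-- The Hamiltonian `H(w)`: the number of pairs `1 ≤ i < j ≤ L` with
`‖u_i - u_j‖ = 1`, i.e. whose doubled midpoints differ by a vector of squared
Euclidean norm `4`. -/
noncomputable def Ham (steps : List (ℤ × ℤ)) : ℕ :=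
  ((Finset.range steps.length ×ˢ Finset.range steps.length).filter fun p =>
      p.1 < p.2 ∧ (dmid steps p.1 - dmid steps p.2).1 ^ 2 +
        (dmid steps p.1 - dmid steps p.2).2 ^ 2 = 4).card

/-! ## IPSAW -/

open scoped Classical in
/-- `Ω_L^PSAW`: the set of `L`-step prudent paths. -/
noncomputable def psawFinset (L : ℕ) : Finset (Fin L → Fin 4) :=
  Finset.univ.filter fun s => IsPrudent (stepsOf s)

/-- `Z_{β,L}`: the partition function of IPSAW. -/
noncomputable def Zpsaw (β : ℝ) (L : ℕ) : ℝ :=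
  ∑ s ∈ psawFinset L, Real.exp (β * (Ham (stepsOf s) : ℝ))

/-! ## Partially directed paths, oriented blocks and NE-prudent paths -/

/-- The vertical run of steps corresponding to a (signed) stretch `ℓ`. -/
def vrun (ℓ : ℤ) : List (ℤ × ℤ) := List.replicate ℓ.natAbs (if 0 ≤ ℓ then (0, 1) else (0, -1))

/-- The horizontal run of steps corresponding to a (signed) stretch `ℓ`. -/
def hrun (ℓ : ℤ) : List (ℤ × ℤ) := List.replicate ℓ.natAbs (if 0 ≤ ℓ then (1, 0) else (-1, 0))

/-- The west-east partially directed path with stretch sequence `ℓs`: vertical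
runs separated by single horizontal inter-stretch steps. -/
def weSteps (ℓs : List ℤ) : List (ℤ × ℤ) := List.intercalate [(1, 0)] (ℓs.map vrun)

/-- The south-north partially directed path with stretch sequence `ℓs`: horizontal
runs separated by single vertical inter-stretch steps. -/
def snSteps (ℓs : List ℤ) : List (ℤ × ℤ) := List.intercalate [(0, 1)] (ℓs.map hrun)

/-- The upper exit condition: `ℓ_1 + ⋯ + ℓ_N > max_{0 ≤ i < N} (ℓ_1 + ⋯ + ℓ_i)`. -/
def upperExit (ℓs : List ℤ) : Prop := ∀ i < ℓs.length, (ℓs.take i).sum < ℓs.sum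

/-- A block of given type: `true` = west-east, `false` = south-north. -/
def blockSteps : Bool → List ℤ → List (ℤ × ℤ)
  | true, ℓs => weSteps ℓs
  | false, ℓs => snSteps ℓs

/-- The concatenation of a sequence of blocks of alternating type, starting with
type `b`. -/
def neSteps : Bool → List (List ℤ) → List (ℤ × ℤ)
  | _, [] => []
  | b, ℓs :: rest => blockSteps b ℓs ++ neSteps (!b) rest

/-- Block data of an NE-prudent path: a nonempty sequence of nonempty stretch
sequences, all blocks but the last satisfying the upper exit condition, and all
blocks but the first having a negative first stretch. -/
def IsNEData (bs : List (List ℤ)) : Prop :=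
  bs ≠ [] ∧ (∀ ℓs ∈ bs, ℓs ≠ []) ∧
  (∀ i : ℕ, i + 1 < bs.length → upperExit (bs.getD i [])) ∧
  (∀ i : ℕ, 0 < i → i < bs.length → (bs.getD i []).headI < 0)

/-- An NE-prudent path: a prudent path obtained as the concatenation of oriented
blocks of alternating type as prescribed by `IsNEData`. -/
def IsNEPath (steps : List (ℤ × ℤ)) : Prop :=
  IsPrudent steps ∧ ∃ (b : Bool) (bs : List (List ℤ)), IsNEData bs ∧ neSteps b bs = steps

open scoped Classical in
/-- `Ω_L^NE`: the set of `L`-step NE-prudent paths. -/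
noncomputable def neFinset (L : ℕ) : Finset (Fin L → Fin 4) :=
  Finset.univ.filter fun s => IsNEPath (stepsOf s)

/-- `Z^NE_{β,L}`: the partition function of NE-IPSAW. -/
noncomputable def Zne (β : ℝ) (L : ℕ) : ℝ :=
  ∑ s ∈ neFinset L, Real.exp (β * (Ham (stepsOf s) : ℝ))

/-! ## Starred and tilde NE sets -/

/-- Block data where all blocks, including the last one, satisfy the upper exit
condition. -/
def IsNEStarData (bs : List (List ℤ)) : Prop :=
  bs ≠ [] ∧ (∀ ℓs ∈ bs, ℓs ≠ []) ∧
  (∀ i : ℕ, i < bs.length → upperExit (bs.getD i [])) ∧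
  (∀ i : ℕ, 0 < i → i < bs.length → (bs.getD i []).headI < 0)

/-- Membership in `Ω_L^{NE,*}`. -/
def IsNEStar (steps : List (ℤ × ℤ)) : Prop :=
  IsPrudent steps ∧ ∃ (b : Bool) (bs : List (List ℤ)), IsNEStarData bs ∧ neSteps b bs = steps

/-- Membership in `Ω̃_L^{NE,*}`: moreover the first stretch of the path has length `0`. -/
def IsNETilde (steps : List (ℤ × ℤ)) : Prop :=
  IsPrudent steps ∧ ∃ (b : Bool) (bs : List (List ℤ)), IsNEStarData bs ∧
    bs.headI.headI = 0 ∧ neSteps b bs = steps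

open scoped Classical in
noncomputable def neStarFinset (L : ℕ) : Finset (Fin L → Fin 4) :=
  Finset.univ.filter fun s => IsNEStar (stepsOf s)

open scoped Classical in
noncomputable def neTildeFinset (L : ℕ) : Finset (Fin L → Fin 4) :=
  Finset.univ.filter fun s => IsNETilde (stepsOf s)

/-- `Z^{NE,*}_{β,L}`. -/
noncomputable def Zstar (β : ℝ) (L : ℕ) : ℝ :=
  ∑ s ∈ neStarFinset L, Real.exp (β * (Ham (stepsOf s) : ℝ))

/-- `Z̃^{NE,*}_{β,L}`. -/
noncomputable def Ztilde (β : ℝ) (L : ℕ) : ℝ :=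
  ∑ s ∈ neTildeFinset L, Real.exp (β * (Ham (stepsOf s) : ℝ))

/-! ## IPDSAW and ISAW -/

/-- A west-east partially directed self-avoiding path: increments in
`{(1,0),(0,1),(0,-1)}` and self-avoiding. -/
def IsPD (steps : List (ℤ × ℤ)) : Prop :=
  (∀ d ∈ steps, d = (1, 0) ∨ d = (0, 1) ∨ d = (0, -1)) ∧ IsSA steps

open scoped Classical in
/-- `Ω_L^PDSAW`. -/
noncomputable def pdFinset (L : ℕ) : Finset (Fin L → Fin 4) :=
  Finset.univ.filter fun s => IsPD (stepsOf s)

/-- `Z^IPDSAW_{β,L}`. -/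
noncomputable def Zipd (β : ℝ) (L : ℕ) : ℝ :=
  ∑ s ∈ pdFinset L, Real.exp (β * (Ham (stepsOf s) : ℝ))

open scoped Classical in
/-- `Ω_L^SAW`. -/
noncomputable def sawFinset (L : ℕ) : Finset (Fin L → Fin 4) :=
  Finset.univ.filter fun s => IsSA (stepsOf s)

/-- `Z^ISAW_{β,L}`. -/
noncomputable def Zisaw (β : ℝ) (L : ℕ) : ℝ :=
  ∑ s ∈ sawFinset L, Real.exp (β * (Ham (stepsOf s) : ℝ))

/-! ## Orientations of two-sided paths -/

/-- The four possible general orientations of a two-sided prudent path. -/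
inductive Orient | NE | NW | SE | SW
deriving DecidableEq

/-- The axial symmetry of `ℤ²` turning an NE-oriented object into an
`x`-oriented one, acting on steps. -/
def osym : Orient → ℤ × ℤ → ℤ × ℤ
  | Orient.NE, d => d
  | Orient.NW, d => (-d.1, d.2)
  | Orient.SE, d => (d.1, -d.2)
  | Orient.SW, d => (-d.1, -d.2)

/-! ## Prudent walks in coordinates -/

/-- The coordinate functions `x, y` describe a prudent nearest-neighbour walk on the time
interval `[a, b]`. -/
structure PrudentOn (a b : ℕ) (x y : ℕ → ℤ) : Prop where
  step : ∀ i, a ≤ i → i < b →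
    (x (i + 1) = x i + 1 ∧ y (i + 1) = y i) ∨ (x (i + 1) = x i - 1 ∧ y (i + 1) = y i) ∨
    (x (i + 1) = x i ∧ y (i + 1) = y i + 1) ∨ (x (i + 1) = x i ∧ y (i + 1) = y i - 1)
  right : ∀ i j, a ≤ j → j ≤ i → i < b → x (i + 1) = x i + 1 → y j = y i → x j ≤ x i
  left : ∀ i j, a ≤ j → j ≤ i → i < b → x (i + 1) = x i - 1 → y j = y i → x i ≤ x j
  up : ∀ i j, a ≤ j → j ≤ i → i < b → y (i + 1) = y i + 1 → x j = x i → y j ≤ y i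
  down : ∀ i j, a ≤ j → j ≤ i → i < b → y (i + 1) = y i - 1 → x j = x i → y i ≤ y j

namespace PrudentOn

variable {a b : ℕ} {x y : ℕ → ℤ}

theorem negX (h : PrudentOn a b x y) : PrudentOn a b (-x) y where
  step i h1 h2 := by have := h.step i h1 h2; simp only [Pi.neg_apply]; omega
  right i j h1 h2 h3 h4 h5 := by
    simp only [Pi.neg_apply] at *
    have := h.left i j h1 h2 h3 (by omega) h5; omega
  left i j h1 h2 h3 h4 h5 := by
    simp only [Pi.neg_apply] at *
    have := h.right i j h1 h2 h3 (by omega) h5; omega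
  up i j h1 h2 h3 h4 h5 := by
    simp only [Pi.neg_apply] at *
    exact h.up i j h1 h2 h3 h4 (by omega)
  down i j h1 h2 h3 h4 h5 := by
    simp only [Pi.neg_apply] at *
    exact h.down i j h1 h2 h3 h4 (by omega)

theorem swap (h : PrudentOn a b x y) : PrudentOn a b y x where
  step i h1 h2 := by have := h.step i h1 h2; omega
  right := h.up
  left := h.down
  up := h.right
  down := h.left

theorem negY (h : PrudentOn a b x y) : PrudentOn a b x (-y) := h.swap.negX.swap

theorem mono (h : PrudentOn a b x y) {s t : ℕ} (hs : a ≤ s) (ht : t ≤ b) :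
    PrudentOn s t x y where
  step i h1 h2 := h.step i (by omega) (by omega)
  right i j h1 h2 h3 := h.right i j (by omega) h2 (by omega)
  left i j h1 h2 h3 := h.left i j (by omega) h2 (by omega)
  up i j h1 h2 h3 := h.up i j (by omega) h2 (by omega)
  down i j h1 h2 h3 := h.down i j (by omega) h2 (by omega)

/-- Prudent walks are self-avoiding. -/
theorem ne_of_lt (h : PrudentOn a b x y) {i j : ℕ} (ha : a ≤ i) (hij : i < j) (hj : j ≤ b)
    (hx : x i = x j) (hy : y i = y j) : False := by
  obtain ⟨k, rfl⟩ : ∃ k, j = k + 1 := ⟨j - 1, by omega⟩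
  rcases h.step k (by omega) (by omega) with h1 | h1 | h1 | h1
  · have := h.right k i ha (by omega) (by omega) h1.1 (by omega); omega
  · have := h.left k i ha (by omega) (by omega) h1.1 (by omega); omega
  · have := h.up k i ha (by omega) (by omega) h1.2 (by omega); omega
  · have := h.down k i ha (by omega) (by omega) h1.2 (by omega); omega

end PrudentOn

/-- Discrete intermediate value theorem for integer sequences with increments at most one. -/
theorem exists_eq_of_le_of_le {f : ℕ → ℤ} {i j : ℕ} (hij : i ≤ j)
    (hf : ∀ k, i ≤ k → k < j → f (k + 1) ≤ f k + 1) {c : ℤ} (h1 : f i ≤ c) (h2 : c ≤ f j) :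
    ∃ k, i ≤ k ∧ k ≤ j ∧ f k = c := by
  induction j, hij using Nat.le_induction with
  | base => exact ⟨i, le_rfl, le_rfl, by omega⟩
  | succ n hn ih =>
    by_cases hc : c ≤ f n
    · obtain ⟨k, hk⟩ := ih (fun k hk hk' => hf k hk (by omega)) hc
      exact ⟨k, hk.1, by omega, hk.2.2⟩
    · have := hf n hn (by omega)
      exact ⟨n + 1, by omega, le_rfl, by omega⟩

theorem exists_eq_of_between {f : ℕ → ℤ} {b : ℕ} {lo : ℕ}
    (hf : ∀ k, lo ≤ k → k < b → f k - 1 ≤ f (k + 1) ∧ f (k + 1) ≤ f k + 1) {i j : ℕ}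
    (hi : lo ≤ i) (hj : lo ≤ j) (hib : i ≤ b) (hjb : j ≤ b) {c : ℤ} (h1 : f i ≤ c) (h2 : c ≤ f j) :
    ∃ k, min i j ≤ k ∧ k ≤ max i j ∧ f k = c := by
  rcases le_total i j with h | h
  · obtain ⟨k, hk⟩ := exists_eq_of_le_of_le h
      (fun k hk hk' => (hf k (by omega) (by omega)).2) h1 h2
    exact ⟨k, by omega, by omega, hk.2.2⟩
  · obtain ⟨k, hk⟩ := exists_eq_of_le_of_le (f := -f) (c := -c) h
      (fun k hk hk' => by
        have := (hf k (by omega) (by omega)).1; simp only [Pi.neg_apply]; omega)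
      (by simp only [Pi.neg_apply]; omega) (by simp only [Pi.neg_apply]; omega)
    simp only [Pi.neg_apply] at hk
    exact ⟨k, by omega, by omega, by omega⟩

namespace PrudentOn

variable {a b : ℕ} {x y : ℕ → ℤ}

theorem stepY (h : PrudentOn a b x y) (k : ℕ) (h1 : a ≤ k) (h2 : k < b) :
    y k - 1 ≤ y (k + 1) ∧ y (k + 1) ≤ y k + 1 := by have := h.step k h1 h2; omega

/-- A left step from the right side of the bounding box enters a row that was not visited before. -/
theorem row_new_of_left (h : PrudentOn a b x y) {t : ℕ} (htb : t < b)
    (hE : ∀ j, a ≤ j → j ≤ t → x j ≤ x t) (hL : x (t + 1) = x t - 1) {j : ℕ} (hj : a ≤ j)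
    (hjt : j < t) : y j ≠ y t := by
  intro hy
  have h1 := h.left t j hj (by omega) htb hL hy
  have h2 := hE j hj (by omega)
  exact h.ne_of_lt hj hjt (by omega) (by omega) hy

/-- A left step from the right side of the bounding box takes place at its top or its bottom. -/
theorem left_at_east (h : PrudentOn a b x y) {t : ℕ} (htb : t < b)
    (hE : ∀ j, a ≤ j → j ≤ t → x j ≤ x t) (hL : x (t + 1) = x t - 1) :
    (∀ j, a ≤ j → j < t → y j < y t) ∨ (∀ j, a ≤ j → j < t → y t < y j) := by
  by_contra hcon
  push Not at hcon
  obtain ⟨⟨i, hi, hit, hyi⟩, ⟨j, hj, hjt, hyj⟩⟩ := hcon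
  obtain ⟨k, hk1, hk2, hk3⟩ := exists_eq_of_between (b := t) (lo := a)
    (fun k hk hk' => h.stepY k hk (by omega)) hj hi (by omega) (by omega) hyj hyi
  exact h.row_new_of_left htb hE hL (j := k) (by omega) (by omega) hk3

end PrudentOn

/-! ## Corner pieces and chains -/

/-- On `[s, t]` the walk makes left steps only at its top, down steps only at its right side, and
it ends in the upper right corner of its bounding box. -/
def CornerOn (x y : ℕ → ℤ) (s t : ℕ) : Prop :=
  (∀ i j, s ≤ j → j ≤ i → i < t → x (i + 1) = x i - 1 → y j ≤ y i) ∧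
  (∀ i j, s ≤ j → j ≤ i → i < t → y (i + 1) = y i - 1 → x j ≤ x i) ∧
  (∀ j, s ≤ j → j ≤ t → x j ≤ x t ∧ y j ≤ y t)

theorem CornerOn.swap {x y : ℕ → ℤ} {s t : ℕ} (h : CornerOn x y s t) : CornerOn y x s t :=
  ⟨h.2.1, h.1, fun j h1 h2 => (h.2.2 j h1 h2).symm⟩

/-- A corner piece up to reflections in the coordinate axes. -/
def ReflCornerOn (x y : ℕ → ℤ) (s t : ℕ) : Prop :=
  CornerOn x y s t ∨ CornerOn (-x) y s t ∨ CornerOn x (-y) s t ∨ CornerOn (-x) (-y) s t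

theorem ReflCornerOn.swap {x y : ℕ → ℤ} {s t : ℕ} (h : ReflCornerOn x y s t) :
    ReflCornerOn y x s t := by
  rcases h with h | h | h | h
  · exact Or.inl h.swap
  · exact Or.inr (Or.inr (Or.inl h.swap))
  · exact Or.inr (Or.inl h.swap)
  · exact Or.inr (Or.inr (Or.inr h.swap))

theorem ReflCornerOn.of_negY {x y : ℕ → ℤ} {s t : ℕ} (h : ReflCornerOn x (-y) s t) :
    ReflCornerOn x y s t := by
  simp only [ReflCornerOn, neg_neg] at *
  tauto

/-- `Chain G k s u`: the interval `[s, u]` is cut into `k` nonempty consecutive intervals, each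
satisfying `G`. -/
inductive Chain (G : ℕ → ℕ → Prop) : ℕ → ℕ → ℕ → Prop
  | nil (s : ℕ) : Chain G 0 s s
  | cons {k s t u : ℕ} : s < t → G s t → Chain G k t u → Chain G (k + 1) s u

namespace Chain

variable {G G' : ℕ → ℕ → Prop} {k l s t u : ℕ}

theorem le (h : Chain G k s t) : s ≤ t := by
  induction h with
  | nil => exact le_rfl
  | cons h1 _ _ ih => omega

theorem append (h : Chain G k s t) (h' : Chain G l t u) : Chain G (k + l) s u := by
  induction h with
  | nil => simpa using h'
  | cons h1 h2 _ ih => rw [add_right_comm]; exact cons h1 h2 (ih h')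

theorem imp (h : Chain G k s u)
    (hG : ∀ v w, s ≤ v → v < w → w ≤ u → G v w → G' v w) : Chain G' k s u := by
  induction h with
  | nil => exact nil _
  | cons h1 h2 h3 ih =>
    exact cons h1 (hG _ _ le_rfl h1 h3.le h2)
      (ih fun v w hv => hG v w (by omega))

theorem exists_cons (hst : s ≤ t) (h : G s t) (h' : Chain G k t u) :
    ∃ m ≤ k + 1, Chain G m s u := by
  rcases hst.eq_or_lt with rfl | hlt
  · exact ⟨k, by omega, h'⟩
  · exact ⟨k + 1, le_rfl, cons hlt h h'⟩

end Chain

/-! ## Cutting a prudent walk into few corner pieces -/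

theorem ReflCornerOn.of_negX {x y : ℕ → ℤ} {s t : ℕ} (h : ReflCornerOn (-x) y s t) :
    ReflCornerOn x y s t := by
  simp only [ReflCornerOn, neg_neg] at *
  tauto

theorem monotone_on_of_step {y : ℕ → ℤ} {a b : ℕ}
    (hy : ∀ k, a ≤ k → k < b → y k ≤ y (k + 1)) {i j : ℕ} (hi : a ≤ i) (hij : i ≤ j)
    (hj : j ≤ b) : y i ≤ y j := by
  induction j, hij using Nat.le_induction with
  | base => exact le_rfl
  | succ n hn ih => exact (ih (by omega)).trans (hy n (by omega) (by omega))

theorem sub_le_of_step {x : ℕ → ℤ} {a b : ℕ}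
    (hx : ∀ k, a ≤ k → k < b → x k - 1 ≤ x (k + 1)) {i j : ℕ} (hi : a ≤ i) (hij : i ≤ j)
    (hj : j ≤ b) : x i - x j ≤ (j : ℤ) - i := by
  induction j, hij using Nat.le_induction with
  | base => simp
  | succ n hn ih =>
    have := ih (by omega)
    have := hx n (by omega) (by omega)
    push_cast; omega

/-- The last time at which a sequence attains its minimum. -/
theorem exists_last_min (x : ℕ → ℤ) {a b : ℕ} (hab : a ≤ b) :
    ∃ m, a ≤ m ∧ m ≤ b ∧ (∀ j, a ≤ j → j ≤ b → x m ≤ x j) ∧ ∀ j, m < j → j ≤ b → x m < x j := by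
  induction b, hab using Nat.le_induction with
  | base => 
    refine ⟨a, le_rfl, le_rfl, fun j h1 h2 => ?_, fun j h1 h2 => by omega⟩
    rw [le_antisymm h1 h2]
  | succ n hn ih =>
    obtain ⟨m, h1, h2, h3, h4⟩ := ih
    by_cases h : x (n + 1) ≤ x m
    · refine ⟨n + 1, by omega, le_rfl, fun j hj hj' => ?_, fun j h1 h2 => by omega⟩
      rcases hj'.eq_or_lt with rfl | hlt
      · exact le_rfl
      · exact h.trans (h3 j hj (by omega))
    · refine ⟨m, h1, by omega, fun j hj hj' => ?_, fun j hj hj' => ?_⟩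
      all_goals
        rcases hj'.eq_or_lt with rfl | hlt
        · omega
      · exact h3 j hj (by omega)
      · exact h4 j hj (by omega)

/-- Unfolding of a walk that stays strictly on one side of its starting column: it is a chain of
corner pieces of strictly decreasing width. -/
theorem exists_chain_of_monotone (W : ℕ) : ∀ (a b : ℕ) (x y : ℕ → ℤ), a ≤ b →
    (∀ k, a ≤ k → k < b → x k - 1 ≤ x (k + 1) ∧ x (k + 1) ≤ x k + 1) →
    (∀ k, a ≤ k → k < b → y k ≤ y (k + 1)) →
    (∀ j, a < j → j ≤ b → x j < x a) → (∀ j, a ≤ j → j ≤ b → x a - x j ≤ W) →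
    ∃ k ≤ W, Chain (ReflCornerOn x y) k a b ∧ k * (k + 1) ≤ 2 * (b - a) := by
  induction W using Nat.strong_induction_on with
  | _ W ih =>
  intro a b x y hab hx hy hlt hW
  rcases hab.eq_or_lt with rfl | hab'
  · exact ⟨0, by omega, Chain.nil a, by simp⟩
  obtain ⟨m, ham, hmb, hmin, hlast⟩ := exists_last_min x hab
  have hxm : x m < x a := (hmin b hab le_rfl).trans_lt (hlt b hab' le_rfl)
  have ham' : a < m := by
    rcases ham.eq_or_lt with rfl | h
    · omega
    · exact h
  obtain ⟨d, hd⟩ : ∃ d : ℕ, x a - x m = d + 1 := ⟨(x a - x m - 1).toNat, by omega⟩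
  have hdW : d < W := by have := hW m ham hmb; omega
  have hdm : d + 1 ≤ m - a := by
    have := sub_le_of_step (fun k h1 h2 => (hx k h1 h2).1) le_rfl ham hmb; omega
  obtain ⟨k, hk, hch, hkb⟩ := ih d hdW m b (-x) y hmb
    (fun k h1 h2 => by have := hx k (by omega) h2; simp only [Pi.neg_apply]; omega)
    (fun k h1 h2 => hy k (by omega) h2)
    (fun j h1 h2 => by have := hlast j h1 h2; simp only [Pi.neg_apply]; omega)
    (fun j h1 h2 => by
      simp only [Pi.neg_apply]
      rcases h1.eq_or_lt with rfl | h
      · omega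
      · have := hlt j (by omega) h2; omega)
  refine ⟨k + 1, by omega, Chain.cons ham' ?_ (hch.imp fun v w _ _ _ h => h.of_negX), ?_⟩
  · refine Or.inr (Or.inl ⟨fun i j h1 h2 h3 _ => ?_, fun i j h1 h2 h3 h4 => ?_, fun j h1 h2 => ?_⟩)
    · exact monotone_on_of_step hy h1 h2 (by omega)
    · have := hy i (by omega) (by omega); omega
    · have := hmin j h1 (by omega)
      exact ⟨by simp only [Pi.neg_apply]; omega, monotone_on_of_step hy h1 h2 hmb⟩
  · have : (k + 1) * (k + 1 + 1) = k * (k + 1) + 2 * (k + 1) := by ring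
    omega

/-- As long as left steps are made only at the top and down steps only at the right side of the
box, the walk remains on the top or right side. -/
theorem top_or_right {a b s : ℕ} {x y : ℕ → ℤ} (h : PrudentOn a b x y) (has : a ≤ s)
    (hs : ∀ j, a ≤ j → j ≤ s → x j ≤ x s ∧ y j ≤ y s) {t : ℕ} (hst : s ≤ t) (htb : t ≤ b)
    (hL : ∀ i, s ≤ i → i < t → x (i + 1) = x i - 1 → ∀ j, a ≤ j → j ≤ i → y j ≤ y i)
    (hD : ∀ i, s ≤ i → i < t → y (i + 1) = y i - 1 → ∀ j, a ≤ j → j ≤ i → x j ≤ x i) :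
    (∀ j, a ≤ j → j ≤ t → x j ≤ x t) ∨ (∀ j, a ≤ j → j ≤ t → y j ≤ y t) := by
  induction t, hst using Nat.le_induction with
  | base => exact Or.inl fun j h1 h2 => (hs j h1 h2).1
  | succ n hn ih =>
    have ih' := ih (by omega) (fun i h1 h2 => hL i h1 (by omega)) (fun i h1 h2 => hD i h1 (by omega))
    have key : ∀ f : ℕ → ℤ, f n ≤ f (n + 1) → (∀ j, a ≤ j → j ≤ n → f j ≤ f n) →
        ∀ j, a ≤ j → j ≤ n + 1 → f j ≤ f (n + 1) := by
      intro f hf hf' j h1 h2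
      rcases h2.eq_or_lt with rfl | hlt
      · exact le_rfl
      · exact (hf' j h1 (by omega)).trans hf
    rcases h.step n (by omega) (by omega) with h1 | h1 | h1 | h1
    · exact ih'.imp (key x (by omega)) (key y (by omega))
    · exact Or.inr (key y (by omega) (hL n hn (by omega) h1.1))
    · exact ih'.imp (key x (by omega)) (key y (by omega))
    · exact Or.inl (key x (by omega) (hD n hn (by omega) h1.2))

/-- The last time at which a predicate holds. -/
theorem exists_last {P : ℕ → Prop} {s t : ℕ} (hst : s ≤ t) (hs : P s) :
    ∃ τ, s ≤ τ ∧ τ ≤ t ∧ P τ ∧ ∀ i, τ < i → i ≤ t → ¬ P i := by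
  induction t, hst using Nat.le_induction with
  | base => exact ⟨s, le_rfl, le_rfl, hs, fun i h1 h2 => by omega⟩
  | succ n hn ih =>
    by_cases h : P (n + 1)
    · exact ⟨n + 1, by omega, le_rfl, h, fun i h1 h2 => by omega⟩
    · obtain ⟨τ, h1, h2, h3, h4⟩ := ih
      refine ⟨τ, h1, by omega, h3, fun i h5 h6 => ?_⟩
      rcases h6.eq_or_lt with rfl | hlt
      · exact h
      · exact h4 i h5 (by omega)

/-- Splitting a walk that ends on the right side at its last visit to the top. -/
theorem exists_split_at_top {a b s : ℕ} {x y : ℕ → ℤ} (h : PrudentOn a b x y) (has : a ≤ s)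
    (hs : ∀ j, a ≤ j → j ≤ s → x j ≤ x s ∧ y j ≤ y s) {t : ℕ} (hst : s ≤ t) (htb : t ≤ b)
    (hL : ∀ i, s ≤ i → i < t → x (i + 1) = x i - 1 → ∀ j, a ≤ j → j ≤ i → y j ≤ y i)
    (hD : ∀ i, s ≤ i → i < t → y (i + 1) = y i - 1 → ∀ j, a ≤ j → j ≤ i → x j ≤ x i)
    (hE : ∀ j, a ≤ j → j ≤ t → x j ≤ x t) :
    ∃ τ, s ≤ τ ∧ τ ≤ t ∧ CornerOn x y s τ ∧ (∀ k, τ ≤ k → k < t → x k ≤ x (k + 1)) ∧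
      ∀ j, τ < j → j ≤ t → y j < y τ := by
  obtain ⟨τ, h1, h2, h3, h4⟩ := exists_last (P := fun τ => ∀ j, a ≤ j → j ≤ τ → y j ≤ y τ) hst
    (fun j h1 h2 => (hs j h1 h2).2)
  have hlt : ∀ j, τ < j → j ≤ t → y j < y τ := by
    intro j
    induction j using Nat.strong_induction_on with
    | _ j ih =>
    intro hj hjt
    by_contra hcon
    refine h4 j hj hjt fun i hi hij => ?_
    by_cases hiτ : i ≤ τ
    · have := h3 i hi hiτ; omega
    · rcases hij.eq_or_lt with rfl | hlt'
      · exact le_rfl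
      · have := ih i hlt' (by omega) (by omega); omega
  refine ⟨τ, h1, h2, ⟨fun i j h5 h6 h7 h8 => hL i (by omega) (by omega) h8 j (by omega) h6,
    fun i j h5 h6 h7 h8 => hD i (by omega) (by omega) h8 j (by omega) h6,
    fun j h5 h6 => ⟨?_, h3 j (by omega) h6⟩⟩, fun k h5 h6 => ?_, hlt⟩
  · rcases h2.eq_or_lt with rfl | hτt
    · exact hE j (by omega) h6
    · have h7 := hlt (τ + 1) (by omega) (by omega)
      have h8 := h.step τ (by omega) (by omega)
      exact hD τ h1 hτt (by omega) j (by omega) h6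
  · by_contra hcon
    have h8 := h.step k (by omega) (by omega)
    have h9 := hL k (by omega) h6 (by omega)
    rcases h5.eq_or_lt with rfl | hτt
    · have := hlt (τ + 1) (by omega) (by omega); omega
    · exact h4 k hτt (by omega) h9

theorem budget_step {D q t s b k m c p : ℕ} (hk : k ≤ m + 1 + 1) (hts : q + 1 ≤ t - s) (htb : t ≤ b)
    (hm : D * m ≤ 2 * D * ((D - p) + (D - (q + 1))) + 2 * (b - t) + c) :
    D * k ≤ 2 * D * ((D - p) + (D - q)) + 2 * (b - s) + c := by
  have h1 : D * k ≤ D * m + 2 * D := by nlinarith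
  by_cases hq : q < D
  · have h2 : D - q = (D - (q + 1)) + 1 := by omega
    have h3 : 2 * D * ((D - p) + (D - q)) = 2 * D * ((D - p) + (D - (q + 1))) + 2 * D := by
      rw [h2]; ring
    omega
  · have h2 : D - q = 0 := by omega
    have h3 : D - (q + 1) = 0 := by omega
    rw [h3] at hm
    rw [h2]
    omega

theorem exists_chain_from_corner (D n : ℕ) : ∀ (a b s p q : ℕ) (x y : ℕ → ℤ), b - s = n →
    PrudentOn a b x y → a ≤ s → s ≤ b → (∀ j, a ≤ j → j ≤ s → x j ≤ x s ∧ y j ≤ y s) →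
    (∃ j, a ≤ j ∧ j ≤ s ∧ p ≤ x s - x j) → (∃ j, a ≤ j ∧ j ≤ s ∧ q ≤ y s - y j) →
    ∃ k, Chain (ReflCornerOn x y) k s b ∧
      D * k ≤ 2 * D * ((D - p) + (D - q)) + 2 * (b - s) + (D + D ^ 2) := by
  induction n using Nat.strong_induction_on with
  | _ n ih =>
  -- a violating left step
  have viol : ∀ (a b s p q t : ℕ) (x y : ℕ → ℤ), b - s = n →
      PrudentOn a b x y → a ≤ s → s ≤ b → (∀ j, a ≤ j → j ≤ s → x j ≤ x s ∧ y j ≤ y s) →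
      (∃ j, a ≤ j ∧ j ≤ s ∧ p ≤ x s - x j) → (∃ j, a ≤ j ∧ j ≤ s ∧ q ≤ y s - y j) →
      s ≤ t → t < b →
      (∀ i, s ≤ i → i < t → x (i + 1) = x i - 1 → ∀ j, a ≤ j → j ≤ i → y j ≤ y i) →
      (∀ i, s ≤ i → i < t → y (i + 1) = y i - 1 → ∀ j, a ≤ j → j ≤ i → x j ≤ x i) →
      x (t + 1) = x t - 1 → (∃ j, a ≤ j ∧ j ≤ t ∧ y t < y j) →
      ∃ k, Chain (ReflCornerOn x y) k s b ∧
        D * k ≤ 2 * D * ((D - p) + (D - q)) + 2 * (b - s) + (D + D ^ 2) := by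
    intro a b s p q t x y hn h has hsb hs hp hq hst htb hL hD hLt ⟨j₀, hj₀, hj₀t, hyj₀⟩
    have hE : ∀ j, a ≤ j → j ≤ t → x j ≤ x t := by
      rcases top_or_right h has hs hst htb.le hL hD with h1 | h1
      · exact h1
      · have := h1 j₀ hj₀ hj₀t; omega
    have hbelow : ∀ j, a ≤ j → j < t → y t < y j := by
      rcases h.left_at_east htb hE hLt with h1 | h1
      · have : j₀ ≠ t := by rintro rfl; omega
        have := h1 j₀ hj₀ (by omega); omega
      · exact h1
    have hst' : s < t := by
      rcases hst.eq_or_lt with rfl | h1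
      · have := (hs j₀ hj₀ hj₀t).2; omega
      · exact h1
    obtain ⟨τ, hsτ, hτt, hcor, hmono, hlow⟩ := exists_split_at_top h has hs hst htb.le hL hD hE
    obtain ⟨jp, hjp, hjps, hjp'⟩ := hp
    obtain ⟨jq, hjq, hjqs, hjq'⟩ := hq
    have hqt : q + 1 ≤ t - s := by
      have h1 := sub_le_of_step (fun k h1 h2 => (h.stepY k h1 h2).1) has hst htb.le
      have h2 := hbelow jq hjq (by omega)
      omega
    obtain ⟨m, hm, hmD⟩ := ih (b - t) (by omega) a b t p (q + 1) x (-y) rfl h.negY (by omega)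
      htb.le (fun j h1 h2 => ⟨hE j h1 h2, by
        rcases h2.eq_or_lt with rfl | h3
        · exact le_rfl
        · have := hbelow j h1 h3; simp only [Pi.neg_apply]; omega⟩)
      ⟨jp, hjp, by omega, by have := hE s has hst; omega⟩
      ⟨s, has, hst, by
        have := hbelow jq hjq (by omega); simp only [Pi.neg_apply]; push_cast; omega⟩
    have hcor' : ReflCornerOn x y τ t := by
      refine Or.inr (Or.inr (Or.inl ⟨fun i j h1 h2 h3 h4 => ?_, fun i j h1 h2 h3 _ => ?_,
        fun j h1 h2 => ⟨hE j (by omega) h2, ?_⟩⟩))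
      · have := hmono i (by omega) h3; omega
      · exact monotone_on_of_step hmono h1 h2 (by omega)
      · rcases h2.eq_or_lt with rfl | h3
        · exact le_rfl
        · have := hbelow j (by omega) h3; simp only [Pi.neg_apply]; omega
    obtain ⟨m₁, hm₁, hch₁⟩ := Chain.exists_cons hτt hcor' (hm.imp fun v w _ _ _ h => h.of_negY)
    obtain ⟨m₂, hm₂, hch₂⟩ := Chain.exists_cons hsτ (Or.inl hcor) hch₁
    exact ⟨m₂, hch₂, budget_step (by omega) hqt htb.le hmD⟩
  -- no violation until the end, which is on the right side
  have tail : ∀ (a b s : ℕ) (x y : ℕ → ℤ),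
      PrudentOn a b x y → a ≤ s → s ≤ b → (∀ j, a ≤ j → j ≤ s → x j ≤ x s ∧ y j ≤ y s) →
      (∀ i, s ≤ i → i < b → x (i + 1) = x i - 1 → ∀ j, a ≤ j → j ≤ i → y j ≤ y i) →
      (∀ i, s ≤ i → i < b → y (i + 1) = y i - 1 → ∀ j, a ≤ j → j ≤ i → x j ≤ x i) →
      (∀ j, a ≤ j → j ≤ b → x j ≤ x b) →
      ∃ k, Chain (ReflCornerOn x y) k s b ∧ D * k ≤ 2 * (b - s) + (D + D ^ 2) := by
    intro a b s x y h has hsb hs hL hD hE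
    obtain ⟨τ, hsτ, hτt, hcor, hmono, hlow⟩ := exists_split_at_top h has hs hsb le_rfl hL hD hE
    obtain ⟨k, _, hch, hk⟩ := exists_chain_of_monotone (b - τ) τ b y x hτt
      (fun k h1 h2 => h.stepY k (by omega) h2) hmono hlow (fun j h1 h2 => by
        have := sub_le_of_step (fun k h1 h2 => (h.stepY k h1 h2).1) (has.trans hsτ) h1 h2
        omega)
    obtain ⟨m, hm, hch'⟩ := Chain.exists_cons hsτ (Or.inl hcor)
      (hch.imp fun v w _ _ _ h => h.swap)
    refine ⟨m, hch', ?_⟩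
    have h1 : D * m ≤ D * k + D := by nlinarith
    have h2 : 2 * (D * k) ≤ k * (k + 1) + D ^ 2 := by
      zify; nlinarith [sq_nonneg ((D : ℤ) - k)]
    omega
  intro a b s p q x y hn h has hsb hs hp hq
  by_cases hv : ∃ t, s ≤ t ∧ t < b ∧
      ((x (t + 1) = x t - 1 ∧ ∃ j, a ≤ j ∧ j ≤ t ∧ y t < y j) ∨
       (y (t + 1) = y t - 1 ∧ ∃ j, a ≤ j ∧ j ≤ t ∧ x t < x j))
  · classical
    obtain ⟨hst, htb, ht⟩ := Nat.find_spec hv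
    set t := Nat.find hv
    have hmin : ∀ i, i < t → ¬ _ := fun i hi => Nat.find_min hv hi
    have hL : ∀ i, s ≤ i → i < t → x (i + 1) = x i - 1 → ∀ j, a ≤ j → j ≤ i → y j ≤ y i := by
      intro i h1 h2 h3 j h4 h5
      by_contra hcon
      exact hmin i h2 ⟨h1, by omega, Or.inl ⟨h3, j, h4, h5, by omega⟩⟩
    have hD : ∀ i, s ≤ i → i < t → y (i + 1) = y i - 1 → ∀ j, a ≤ j → j ≤ i → x j ≤ x i := by
      intro i h1 h2 h3 j h4 h5
      by_contra hcon
      exact hmin i h2 ⟨h1, by omega, Or.inr ⟨h3, j, h4, h5, by omega⟩⟩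
    rcases ht with ht | ht
    · exact viol a b s p q t x y hn h has hsb hs hp hq hst htb hL hD ht.1 ht.2
    · obtain ⟨k, hk, hkD⟩ := viol a b s q p t y x hn h.swap has hsb
        (fun j h1 h2 => (hs j h1 h2).symm) hq hp hst htb hD hL ht.1 ht.2
      exact ⟨k, hk.imp fun v w _ _ _ h => h.swap, by rwa [add_comm (D - p)]⟩
  · push Not at hv
    have hL : ∀ i, s ≤ i → i < b → x (i + 1) = x i - 1 → ∀ j, a ≤ j → j ≤ i → y j ≤ y i :=
      fun i h1 h2 => (hv i h1 h2).1
    have hD : ∀ i, s ≤ i → i < b → y (i + 1) = y i - 1 → ∀ j, a ≤ j → j ≤ i → x j ≤ x i :=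
      fun i h1 h2 => (hv i h1 h2).2
    rcases top_or_right h has hs hsb le_rfl hL hD with hE | hN
    · obtain ⟨k, hk, hkD⟩ := tail a b s x y h has hsb hs hL hD hE
      exact ⟨k, hk, by omega⟩
    · obtain ⟨k, hk, hkD⟩ := tail a b s y x h.swap has hsb
        (fun j h1 h2 => (hs j h1 h2).symm) hD hL hN
      exact ⟨k, hk.imp fun v w _ _ _ h => h.swap, by omega⟩

/-- A prudent walk of length `n` is a concatenation of `O(n / D) + C_D` corner pieces. -/
theorem PrudentOn.exists_chain {a b : ℕ} {x y : ℕ → ℤ} (h : PrudentOn a b x y) (hab : a ≤ b)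
    (D : ℕ) : ∃ k, Chain (ReflCornerOn x y) k a b ∧ D * k ≤ 2 * (b - a) + (D + 5 * D ^ 2) := by
  obtain ⟨k, hk, hkD⟩ := exists_chain_from_corner D (b - a) a b a 0 0 x y rfl h le_rfl hab
    (fun j h1 h2 => by rw [le_antisymm h1 h2]; exact ⟨le_rfl, le_rfl⟩)
    ⟨a, le_rfl, le_rfl, by simp⟩ ⟨a, le_rfl, le_rfl, by simp⟩
  refine ⟨k, hk, hkD.trans (le_of_eq ?_)⟩
  simp only [Nat.sub_zero]; ring

/-! ## Self-touchings of prudent walks -/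

/-- The current position lies on the boundary of the bounding box of the past. -/
def OnBoundary (x y : ℕ → ℤ) (i : ℕ) : Prop :=
  (∀ j ≤ i, y j ≤ y i) ∨ (∀ j ≤ i, y i ≤ y j) ∨ (∀ j ≤ i, x j ≤ x i) ∨ (∀ j ≤ i, x i ≤ x j)

theorem OnBoundary.negX {x y : ℕ → ℤ} {i : ℕ} (h : OnBoundary x y i) : OnBoundary (-x) y i := by
  simp only [OnBoundary, Pi.neg_apply, neg_le_neg_iff] at *; tauto

theorem OnBoundary.swap {x y : ℕ → ℤ} {i : ℕ} (h : OnBoundary x y i) : OnBoundary y x i := by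
  simp only [OnBoundary] at *; tauto

namespace PrudentOn

variable {L : ℕ} {x y : ℕ → ℤ}

theorem left_side_aux (h : PrudentOn 0 L x y) {i : ℕ} (hi : i < L) (hb : OnBoundary x y i)
    (hL : x (i + 1) = x i - 1) :
    (∀ j ≤ i, y j ≤ y i) ∨ (∀ j ≤ i, y i ≤ y j) ∨ (∀ j ≤ i, x i ≤ x j) := by
  rcases hb with hb | hb | hb | hb
  · exact Or.inl hb
  · exact Or.inr (Or.inl hb)
  · rcases h.left_at_east hi (fun j _ => hb j) hL with h1 | h1
    · refine Or.inl fun j hj => ?_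
      rcases hj.eq_or_lt with rfl | hlt
      · exact le_rfl
      · exact (h1 j (Nat.zero_le j) hlt).le
    · refine Or.inr (Or.inl fun j hj => ?_)
      rcases hj.eq_or_lt with rfl | hlt
      · exact le_rfl
      · exact (h1 j (Nat.zero_le j) hlt).le
  · exact Or.inr (Or.inr hb)

theorem onBoundary_succ_of_left (h : PrudentOn 0 L x y) {i : ℕ} (hi : i < L)
    (hb : OnBoundary x y i) (hL : x (i + 1) = x i - 1) : OnBoundary x y (i + 1) := by
  have hy : y (i + 1) = y i := by have := h.step i (Nat.zero_le i) hi; omega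
  rcases h.left_side_aux hi hb hL with h1 | h1 | h1
  · refine Or.inl fun j hj => ?_
    rcases hj.eq_or_lt with rfl | hlt
    · exact le_rfl
    · have := h1 j (by omega); omega
  · refine Or.inr (Or.inl fun j hj => ?_)
    rcases hj.eq_or_lt with rfl | hlt
    · exact le_rfl
    · have := h1 j (by omega); omega
  · refine Or.inr (Or.inr (Or.inr fun j hj => ?_))
    rcases hj.eq_or_lt with rfl | hlt
    · exact le_rfl
    · have := h1 j (by omega); omega

theorem onBoundary (h : PrudentOn 0 L x y) {i : ℕ} (hi : i ≤ L) : OnBoundary x y i := by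
  induction i with
  | zero => exact Or.inl fun j hj => by rw [Nat.le_zero.mp hj]
  | succ n ih =>
    have ih := ih (by omega)
    rcases h.step n (Nat.zero_le n) hi with h1 | h1 | h1 | h1
    · have := (h.negX.onBoundary_succ_of_left hi ih.negX
        (by simp only [Pi.neg_apply]; omega)).negX
      rwa [neg_neg] at this
    · exact h.onBoundary_succ_of_left hi ih h1.1
    · have := (h.swap.negX.onBoundary_succ_of_left hi ih.swap.negX
        (by simp only [Pi.neg_apply]; omega)).negX.swap
      rwa [neg_neg] at this
    · exact (h.swap.onBoundary_succ_of_left hi ih.swap h1.2).swap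

/-- A left step starts on the top, bottom or left side. -/
theorem left_side (h : PrudentOn 0 L x y) {i : ℕ} (hi : i < L) (hL : x (i + 1) = x i - 1) :
    (∀ j ≤ i, y j ≤ y i) ∨ (∀ j ≤ i, y i ≤ y j) ∨ (∀ j ≤ i, x i ≤ x j) :=
  h.left_side_aux hi (h.onBoundary hi.le) hL

/-- A right step starts on the top, bottom or right side. -/
theorem right_side (h : PrudentOn 0 L x y) {i : ℕ} (hi : i < L) (hR : x (i + 1) = x i + 1) :
    (∀ j ≤ i, y j ≤ y i) ∨ (∀ j ≤ i, y i ≤ y j) ∨ (∀ j ≤ i, x j ≤ x i) := by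
  have := h.negX.left_side hi (by simp only [Pi.neg_apply]; omega)
  simpa only [Pi.neg_apply, neg_le_neg_iff] using this

end PrudentOn

/-- The steps number `j` and `i` of the walk touch: their midpoints are at distance one. -/
def Touch (x y : ℕ → ℤ) (j i : ℕ) : Prop :=
  (x j + x (j + 1) - (x i + x (i + 1))) ^ 2 + (y j + y (j + 1) - (y i + y (i + 1))) ^ 2 = 4

theorem Touch.swap {x y : ℕ → ℤ} {j i : ℕ} (h : Touch x y j i) : Touch y x j i := by
  unfold Touch at *; omega

theorem Touch.negX {x y : ℕ → ℤ} {j i : ℕ} (h : Touch x y j i) : Touch (-x) y j i := by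
  unfold Touch at *; simp only [Pi.neg_apply]; rw [← h]; ring

theorem Touch.cases {x y : ℕ → ℤ} {j i : ℕ} (h : Touch x y j i) :
    (x j + x (j + 1) = x i + x (i + 1) ∧
      (y j + y (j + 1) = y i + y (i + 1) + 2 ∨ y j + y (j + 1) = y i + y (i + 1) - 2)) ∨
    (y j + y (j + 1) = y i + y (i + 1) ∧
      (x j + x (j + 1) = x i + x (i + 1) + 2 ∨ x j + x (j + 1) = x i + x (i + 1) - 2)) := by
  unfold Touch at h
  generalize hu : x j + x (j + 1) - (x i + x (i + 1)) = u at h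
  generalize hv : y j + y (j + 1) - (y i + y (i + 1)) = v at h
  have h1 : u ≤ 2 := by nlinarith [sq_nonneg v]
  have h2 : -2 ≤ u := by nlinarith [sq_nonneg v]
  have h3 : v ≤ 2 := by nlinarith [sq_nonneg u]
  have h4 : -2 ≤ v := by nlinarith [sq_nonneg u]
  interval_cases u <;> interval_cases v <;> omega

/-- Step `j` is parallel to the horizontal step `i` and lies right below it. -/
def Below (x y : ℕ → ℤ) (j i : ℕ) : Prop :=
  y (i + 1) = y i ∧ y j = y i - 1 ∧ y (j + 1) = y i - 1 ∧ x j + x (j + 1) = x i + x (i + 1)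

namespace PrudentOn

variable {L : ℕ} {x y : ℕ → ℤ}

theorem touch_horizontal (h : PrudentOn 0 L x y) {i j : ℕ} (hi : i < L) (hj : j < i)
    (hR : x (i + 1) = x i + 1) (ht : Touch x y j i) :
    j + 1 = i ∨ Below x y j i ∨ Below x (-y) j i := by
  have hsi := h.step i (Nat.zero_le i) hi
  have hsj := h.step j (Nat.zero_le j) (by omega)
  simp only [Below, Pi.neg_apply]
  rcases ht.cases with ⟨h1, h2 | h2⟩ | ⟨h1, h2 | h2⟩
  · omega
  · omega
  · have h3 := h.right i j (Nat.zero_le j) hj.le hi hR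
    have h4 := h.right i (j + 1) (Nat.zero_le _) (by omega) hi hR
    omega
  · by_contra hcon
    have h3 : j + 1 ≠ i := fun h => hcon (Or.inl h)
    clear hcon
    have h4 : y j = y i ∧ y (j + 1) = y i := by omega
    have h5 : x j = x i ∨ x (j + 1) = x i := by omega
    rcases h5 with h5 | h5
    · exact h.ne_of_lt (Nat.zero_le j) hj hi.le h5 h4.1
    · exact h.ne_of_lt (Nat.zero_le (j + 1)) (by omega) hi.le h5 h4.2

/-- A touching of an earlier step is consecutive, or lateral. -/
theorem touch_cases (h : PrudentOn 0 L x y) {i j : ℕ} (hi : i < L) (hj : j < i)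
    (ht : Touch x y j i) :
    j + 1 = i ∨ Below x y j i ∨ Below x (-y) j i ∨ Below y x j i ∨ Below y (-x) j i := by
  have hneg : ∀ u v : ℕ → ℤ, Below (-u) v j i → Below u v j i := by
    intro u v hb
    simp only [Below, Pi.neg_apply] at *
    omega
  rcases h.step i (Nat.zero_le i) hi with h1 | h1 | h1 | h1
  · have := h.touch_horizontal hi hj h1.1 ht; tauto
  · have := h.negX.touch_horizontal hi hj (by simp only [Pi.neg_apply]; omega) ht.negX
    have h2 := hneg x y
    have h3 := hneg x (-y)
    tauto
  · have := h.swap.touch_horizontal hi hj h1.2 ht.swap; tauto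
  · have := h.swap.negX.touch_horizontal hi hj (by simp only [Pi.neg_apply]; omega) ht.swap.negX
    have h2 := hneg y x
    have h3 := hneg y (-x)
    tauto

/-- A horizontal step above an earlier one takes place on the top side. -/
theorem top_of_below (h : PrudentOn 0 L x y) {i j : ℕ} (hi : i < L) (hj : j < i)
    (hb : Below x y j i) : ∀ k ≤ i, y k ≤ y i := by
  obtain ⟨h1, h2, h3, h4⟩ := hb
  have hsi := h.step i (Nat.zero_le i) hi
  have hsj := h.step j (Nat.zero_le j) (by omega)
  have key : x (i + 1) = x i + 1 ∨ x (i + 1) = x i - 1 := by omega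
  rcases key with h5 | h5
  · rcases h.right_side hi h5 with h6 | h6 | h6
    · exact h6
    · have := h6 j hj.le; omega
    · have := h6 j hj.le; have := h6 (j + 1) hj; omega
  · rcases h.left_side hi h5 with h6 | h6 | h6
    · exact h6
    · have := h6 j hj.le; omega
    · have := h6 j hj.le; have := h6 (j + 1) hj; omega

theorem below_unique (h : PrudentOn 0 L x y) {i j k : ℕ} (hi : i < L) (hj : j < i) (hk : k < i)
    (hbj : Below x y j i) (hbk : Below x y k i) : j = k := by
  have hsi := h.step i (Nat.zero_le i) hi
  have hsj := h.step j (Nat.zero_le j) (by omega)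
  have hsk := h.step k (Nat.zero_le k) (by omega)
  have key : ∀ m n, m ≤ L → n ≤ L → x m = x n → y m = y n → m = n := by
    intro m n hm hn h1 h2
    by_contra hne
    rcases Nat.lt_or_gt_of_ne hne with hlt | hlt
    · exact h.ne_of_lt (Nat.zero_le _) hlt hn h1 h2
    · exact h.ne_of_lt (Nat.zero_le _) hlt hm h1.symm h2.symm
  simp only [Below] at hbj hbk
  by_cases hx : x j = x k
  · exact key j k (by omega) (by omega) hx (by omega)
  · have h1 := key j (k + 1) (by omega) (by omega) (by omega) (by omega)
    have h2 := key (j + 1) k (by omega) (by omega) (by omega) (by omega)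
    omega

theorem lateral_unique (h : PrudentOn 0 L x y) {i j k : ℕ} (hi : i < L) (hj : j < i) (hk : k < i)
    (hbj : Below x y j i ∨ Below x (-y) j i ∨ Below y x j i ∨ Below y (-x) j i)
    (hbk : Below x y k i ∨ Below x (-y) k i ∨ Below y x k i ∨ Below y (-x) k i) : j = k := by
  have hsi := h.step i (Nat.zero_le i) hi
  have opp : ∀ {u v : ℕ → ℤ} (_ : PrudentOn 0 L u v) {m n : ℕ}, m < i → n < i →
      Below u v m i → Below u (-v) n i → False := by
    intro u v hp m n hm hn h1 h2
    have := hp.top_of_below hi hm h1 n hn.le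
    simp only [Below, Pi.neg_apply] at h2
    omega
  have perp : ∀ {u v w z : ℕ → ℤ} {m n : ℕ}, (u = x ∨ u = -x) → (v = y ∨ v = -y) →
      Below w v m i → Below z u n i → False := by
    rintro u v w z m n (rfl | rfl) (rfl | rfl) h1 h2 <;>
    · simp only [Below, Pi.neg_apply] at h1 h2; omega
  rcases hbj with h1 | h1 | h1 | h1 <;> rcases hbk with h2 | h2 | h2 | h2
  · exact h.below_unique hi hj hk h1 h2
  · exact (opp h hj hk h1 h2).elim
  · exact (perp (Or.inl rfl) (Or.inl rfl) h1 h2).elim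
  · exact (perp (Or.inr rfl) (Or.inl rfl) h1 h2).elim
  · exact (opp h hk hj h2 h1).elim
  · exact h.negY.below_unique hi hj hk h1 h2
  · exact (perp (Or.inl rfl) (Or.inr rfl) h1 h2).elim
  · exact (perp (Or.inr rfl) (Or.inr rfl) h1 h2).elim
  · exact (perp (Or.inl rfl) (Or.inl rfl) h2 h1).elim
  · exact (perp (Or.inl rfl) (Or.inr rfl) h2 h1).elim
  · exact h.swap.below_unique hi hj hk h1 h2
  · exact (opp h.swap hj hk h1 h2).elim
  · exact (perp (Or.inr rfl) (Or.inl rfl) h2 h1).elim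
  · exact (perp (Or.inr rfl) (Or.inr rfl) h2 h1).elim
  · exact (opp h.swap hk hj h2 h1).elim
  · exact h.swap.negY.below_unique hi hj hk h1 h2

open scoped Classical in
/-- A step of a prudent walk touches at most two earlier steps. -/
theorem card_touch_le (h : PrudentOn 0 L x y) {i : ℕ} (hi : i < L) :
    ((Finset.range i).filter fun j => Touch x y j i).card ≤ 2 := by
  have h1 : (((Finset.range i).filter fun j => Touch x y j i).erase (i - 1)).card ≤ 1 := by
    refine Finset.card_le_one.mpr fun j hj k hk => ?_
    simp only [Finset.mem_erase, Finset.mem_filter, Finset.mem_range] at hj hk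
    refine h.lateral_unique hi hj.2.1 hk.2.1 ?_ ?_
    · exact (h.touch_cases hi hj.2.1 hj.2.2).resolve_left (by omega)
    · exact (h.touch_cases hi hk.2.1 hk.2.2).resolve_left (by omega)
  have := Finset.pred_card_le_card_erase (s := (Finset.range i).filter fun j => Touch x y j i)
    (a := i - 1)
  omega

end PrudentOn

/-! ## Long runs and touchings across a cut -/

/-- The walk goes straight on `[u, v]`. -/
def StraightOn (x y : ℕ → ℤ) (u v : ℕ) : Prop :=
  ∃ p q : ℤ, ∀ k, u ≤ k → k < v → x (k + 1) = x k + p ∧ y (k + 1) = y k + q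

theorem StraightOn.swap {x y : ℕ → ℤ} {u v : ℕ} : StraightOn x y u v → StraightOn y x u v :=
  fun ⟨p, q, h⟩ => ⟨q, p, fun k h1 h2 => (h k h1 h2).symm⟩

theorem StraightOn.negX {x y : ℕ → ℤ} {u v : ℕ} : StraightOn x y u v → StraightOn (-x) y u v :=
  fun ⟨p, q, h⟩ => ⟨-p, q, fun k h1 h2 => by
    have := h k h1 h2; simp only [Pi.neg_apply]; omega⟩

/-- Step `i` of a walk of length `L` belongs to a straight stretch of more than `K` steps. -/
def LongStep (x y : ℕ → ℤ) (L K i : ℕ) : Prop :=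
  ∃ u v, u ≤ i ∧ i < v ∧ v ≤ L ∧ K < v - u ∧ StraightOn x y u v

theorem LongStep.swap {x y : ℕ → ℤ} {L K i : ℕ} :
    LongStep x y L K i → LongStep y x L K i :=
  fun ⟨u, v, h1, h2, h3, h4, h5⟩ => ⟨u, v, h1, h2, h3, h4, h5.swap⟩

theorem LongStep.negX {x y : ℕ → ℤ} {L K i : ℕ} :
    LongStep x y L K i → LongStep (-x) y L K i :=
  fun ⟨u, v, h1, h2, h3, h4, h5⟩ => ⟨u, v, h1, h2, h3, h4, h5.negX⟩

theorem longStep_negX_iff {x y : ℕ → ℤ} {L K i : ℕ} :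
    LongStep (-x) y L K i ↔ LongStep x y L K i :=
  ⟨fun h => by simpa using h.negX, LongStep.negX⟩

theorem longStep_swap_iff {x y : ℕ → ℤ} {L K i : ℕ} :
    LongStep y x L K i ↔ LongStep x y L K i := ⟨LongStep.swap, LongStep.swap⟩

theorem LongStep.anti {x y : ℕ → ℤ} {L K Q i : ℕ} (hKQ : K ≤ Q) :
    LongStep x y L Q i → LongStep x y L K i :=
  fun ⟨u, v, h1, h2, h3, h4, h5⟩ => ⟨u, v, h1, h2, h3, by omega, h5⟩

namespace PrudentOn

variable {L : ℕ} {x y : ℕ → ℤ}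

/-- A walk that stays in a row goes straight. -/
theorem straightOn_of_row (h : PrudentOn 0 L x y) {u v : ℕ} (hv : v ≤ L)
    (hy : ∀ k, u ≤ k → k ≤ v → y k = y u) : StraightOn x y u v := by
  refine ⟨x (u + 1) - x u, 0, fun k h1 h2 => ⟨?_, ?_⟩⟩
  · induction k, h1 using Nat.le_induction with
    | base => ring
    | succ n hn ih =>
      have ih := ih (by omega)
      have h1 := h.step n (Nat.zero_le _) (by omega)
      have h2 := h.step (n + 1) (Nat.zero_le _) (by omega)
      have h3 := hy n hn (by omega)
      have h4 := hy (n + 1) (by omega) (by omega)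
      have h5 := hy (n + 1 + 1) (by omega) (by omega)
      have h6 : x n ≠ x (n + 1 + 1) := fun h7 =>
        h.ne_of_lt (Nat.zero_le n) (by omega : n < n + 1 + 1) (by omega) h7 (by omega)
      omega
  · have := hy k h1 (by omega)
    have := hy (k + 1) (by omega) (by omega)
    omega

/-- A walk returning from the right side to its top row cannot come back over the past. -/
theorem not_below_of_return (h : PrudentOn 0 L x y) {i m l j : ℕ} (hl : l < L) (him : i < m)
    (hml : m < l) (hj : j < i) (hE : ∀ k ≤ m, x k ≤ x m) (hym : y (m + 1) = y i)
    (hU : y (m + 1) = y m + 1)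
    (hrow : ∀ k, m + 1 ≤ k → k ≤ l → y k = y i) (hb : Below x y j l) : False := by
  have hxm : x (m + 1) = x m := by have := h.step m (Nat.zero_le _) (by omega); omega
  have hxi : x i < x m := by
    have h1 := hE i him.le
    have h2 : x i ≠ x m := fun h3 =>
      h.ne_of_lt (Nat.zero_le i) (by omega : i < m + 1) (by omega) (by omega) hym.symm
    omega
  have hright : ∀ k, m + 1 ≤ k → k ≤ l → x m ≤ x k := by
    intro k hk
    induction k, hk using Nat.le_induction with
    | base => intro; omega
    | succ n hn ih =>
      intro hnl
      have ih := ih (by omega)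
      have h1 := h.step n (Nat.zero_le _) (by omega)
      have h2 := h.left n i (Nat.zero_le _) (by omega) (by omega)
      have h3 := hrow n hn (by omega)
      omega
  obtain ⟨h1, h2, h3, h4⟩ := hb
  have h5 := h.step l (Nat.zero_le _) hl
  have h6 := hright l (by omega) le_rfl
  have h7 := h.left l i (Nat.zero_le _) (by omega) hl
  have h8 := hrow l (by omega) le_rfl
  have h9 := hE j (by omega)
  have h10 := hE (j + 1) (by omega)
  have h11 := h.step j (Nat.zero_le _) (by omega)
  omega

/-- Two steps on the top row, the second of which lies above a step made before the first one,
belong to the same straight stretch. -/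
theorem row_of_below (h : PrudentOn 0 L x y) {i l j : ℕ} (hl : l < L) (hil : i < l) (hj : j < i)
    (hyl : y l = y i) (hb : Below x y j l) :
    ∀ k, i ≤ k → k ≤ l + 1 → y k = y i := by
  have htop := h.top_of_below hl (by omega) hb
  by_contra hcon
  push Not at hcon
  obtain ⟨k, hik, hkl, hk⟩ := hcon
  have hkl' : k ≤ l := by
    by_contra hk2
    have : k = l + 1 := by omega
    subst this
    have := hb.1
    omega
  obtain ⟨m, hkm, hml, hm, hlast⟩ := exists_last (P := fun m => y m ≠ y i) hkl' hk
  have hml' : m < l := by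
    rcases hml.eq_or_lt with rfl | h1
    · exact absurd hyl hm
    · exact h1
  simp only [not_not] at hlast
  have him : i < m := by
    rcases (hik.trans hkm).eq_or_lt with rfl | h1
    · exact absurd rfl hm
    · exact h1
  have hym := hlast (m + 1) (by omega) (by omega)
  have hU : y (m + 1) = y m + 1 := by
    have h1 := htop m (by omega)
    have h2 := h.step m (Nat.zero_le _) (by omega)
    omega
  have hrow : ∀ k, m + 1 ≤ k → k ≤ l → y k = y i := fun k h1 h2 => hlast k (by omega) h2
  rcases h.swap.right_side (by omega : m < L) hU with h1 | h1 | h1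
  · exact h.not_below_of_return hl him hml' hj h1 hym hU hrow hb
  · refine h.negX.not_below_of_return hl him hml' hj ?_ hym hU hrow ?_
    · intro k hk; have := h1 k hk; simp only [Pi.neg_apply]; omega
    · simp only [Below, Pi.neg_apply] at *; omega
  · have := h1 i him.le; omega

open scoped Classical in
/-- The steps after time `s`, not in long stretches, that lie above some step before time `s`. -/
noncomputable def belowSet (x y : ℕ → ℤ) (L K s : ℕ) : Finset ℕ :=
  (Finset.range L).filter fun i => s ≤ i ∧ ¬ LongStep x y L K i ∧ ∃ j < s, Below x y j i

theorem card_le_of_forall_lt {A : Finset ℕ} {K : ℕ}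
    (hA : ∀ i ∈ A, ∀ l ∈ A, i ≤ l → l < i + K) : A.card ≤ K := by
  rcases A.eq_empty_or_nonempty with rfl | hne
  · simp
  · have h1 : A ⊆ Finset.Ico (A.min' hne) (A.min' hne + K) := by
      intro i hi
      have h2 := A.min'_le i hi
      exact Finset.mem_Ico.mpr ⟨h2, hA _ (A.min'_mem hne) i hi h2⟩
    simpa using Finset.card_le_card h1

theorem card_belowSet_le (h : PrudentOn 0 L x y) {K s : ℕ} (hK : 0 < K) :
    (belowSet x y L K s).card ≤ 2 * K := by
  classical
  by_cases hne : (belowSet x y L K s).Nonempty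
  swap
  · rw [Finset.not_nonempty_iff_eq_empty.mp hne]; simp
  set A := belowSet x y L K s with hAdef
  have hrow : ∀ i ∈ A, ∀ l ∈ A, i ≤ l → y i = y l → l < i + K := by
    intro i hi l hl hil hy
    simp only [hAdef, belowSet, Finset.mem_filter, Finset.mem_range] at hi hl
    rcases hil.eq_or_lt with rfl | hlt
    · omega
    obtain ⟨hlL, hsl, hlong, j, hj, hb⟩ := hl
    have h1 := h.row_of_below hlL hlt (by omega : j < i) hy.symm hb
    by_contra hcon
    exact hlong ⟨i, l + 1, by omega, by omega, by omega, by omega,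
      h.straightOn_of_row (by omega) h1⟩
  obtain ⟨i₀, hi₀, hmin⟩ := A.exists_min_image y hne
  have hvals : ∀ l ∈ A, y l = y i₀ ∨ y l = y i₀ + 1 := by
    intro l hl
    have h0 := hmin l hl
    simp only [hAdef, belowSet, Finset.mem_filter, Finset.mem_range] at hi₀ hl
    obtain ⟨hlL, hsl, hlong, j, hj, hb⟩ := hl
    obtain ⟨hlL', hsl', hlong', j', hj', hb'⟩ := hi₀
    have h1 := h.top_of_below hlL' (by omega) hb' j (by omega)
    have h2 := hb.2.1
    omega
  have h1 : (A.filter fun l => y l = y i₀).card ≤ K := card_le_of_forall_lt fun i hi l hl hil => by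
    simp only [Finset.mem_filter] at hi hl
    exact hrow i hi.1 l hl.1 hil (by omega)
  have h2 : (A.filter fun l => ¬ y l = y i₀).card ≤ K :=
    card_le_of_forall_lt fun i hi l hl hil => by
    simp only [Finset.mem_filter] at hi hl
    have := hvals i hi.1
    have := hvals l hl.1
    exact hrow i hi.1 l hl.1 hil (by omega)
  rw [← Finset.card_filter_add_card_filter_not (s := A) (fun l => y l = y i₀)]
  omega

open scoped Classical in
/-- The steps after time `s`, not in long stretches, that touch some step before time `s`. -/
noncomputable def crossSet (x y : ℕ → ℤ) (L K s : ℕ) : Finset ℕ :=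
  (Finset.range L).filter fun i => s ≤ i ∧ ¬ LongStep x y L K i ∧ ∃ j < s, Touch x y j i

theorem card_crossSet_le (h : PrudentOn 0 L x y) {K s : ℕ} (hK : 0 < K) :
    (crossSet x y L K s).card ≤ 8 * K + 1 := by
  classical
  have hsub : crossSet x y L K s ⊆ {s} ∪ ((belowSet x y L K s ∪ belowSet x (-y) L K s) ∪
      (belowSet y x L K s ∪ belowSet y (-x) L K s)) := by
    intro i hi
    simp only [crossSet, Finset.mem_filter, Finset.mem_range] at hi
    obtain ⟨hiL, hsi, hlong, j, hj, ht⟩ := hi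
    have e1 : LongStep x (-y) L K i ↔ LongStep x y L K i := by
      rw [← longStep_swap_iff, longStep_negX_iff, longStep_swap_iff]
    have e2 : LongStep y x L K i ↔ LongStep x y L K i := longStep_swap_iff
    have e3 : LongStep y (-x) L K i ↔ LongStep x y L K i := by
      rw [← longStep_swap_iff, longStep_negX_iff]
    simp only [belowSet, Finset.mem_union, Finset.mem_singleton, Finset.mem_filter,
      Finset.mem_range, e1, e2, e3]
    rcases h.touch_cases hiL (by omega) ht with h1 | h1 | h1 | h1 | h1
    · left; omega
    · right; left; left; exact ⟨hiL, hsi, hlong, j, hj, h1⟩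
    · right; left; right; exact ⟨hiL, hsi, hlong, j, hj, h1⟩
    · right; right; left; exact ⟨hiL, hsi, hlong, j, hj, h1⟩
    · right; right; right; exact ⟨hiL, hsi, hlong, j, hj, h1⟩
  have c0 := Finset.card_le_card hsub
  have c1 := h.card_belowSet_le (s := s) hK
  have c2 := h.negY.card_belowSet_le (s := s) hK
  have c3 := h.swap.card_belowSet_le (s := s) hK
  have c4 := h.swap.negY.card_belowSet_le (s := s) hK
  have u1 := Finset.card_union_le ({s} : Finset ℕ) ((belowSet x y L K s ∪ belowSet x (-y) L K s) ∪
      (belowSet y x L K s ∪ belowSet y (-x) L K s))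
  have u2 := Finset.card_union_le (belowSet x y L K s ∪ belowSet x (-y) L K s)
      (belowSet y x L K s ∪ belowSet y (-x) L K s)
  have u3 := Finset.card_union_le (belowSet x y L K s) (belowSet x (-y) L K s)
  have u4 := Finset.card_union_le (belowSet y x L K s) (belowSet y (-x) L K s)
  rw [Finset.card_singleton] at u1
  omega

end PrudentOn

/-! ## Cutting out the long stretches -/

/-- A corner piece without long straight stretches, or a straight piece. -/
def PieceOn (x y : ℕ → ℤ) (L Q s t : ℕ) : Prop :=
  (ReflCornerOn x y s t ∧ ∀ i, s ≤ i → i < t → ¬ LongStep x y L Q i) ∨ StraightOn x y s t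

theorem StraightOn.extend {x y : ℕ → ℤ} {t u v : ℕ} (h : StraightOn x y t v) (htv : t < v)
    (h' : StraightOn x y u (v + 1)) (huv : u < v) : StraightOn x y t (v + 1) := by
  obtain ⟨p, q, h1⟩ := h
  obtain ⟨p', q', h2⟩ := h'
  refine ⟨p, q, fun k hk hkv => ?_⟩
  by_cases hkv' : k < v
  · exact h1 k hk hkv'
  · obtain rfl : k = v := by omega
    have h3 := h1 (k - 1) (by omega) (by omega)
    have h4 := h2 (k - 1) (by omega) (by omega)
    have h5 := h2 k (by omega) (by omega)
    omega

theorem StraightOn.mono {x y : ℕ → ℤ} {s t u v : ℕ} (h : StraightOn x y s t) (hsu : s ≤ u)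
    (hvt : v ≤ t) : StraightOn x y u v := by
  obtain ⟨p, q, h1⟩ := h
  exact ⟨p, q, fun k hk hkv => h1 k (by omega) (by omega)⟩

namespace PrudentOn

variable {L : ℕ} {x y : ℕ → ℤ}

theorem exists_pieces_from (h : PrudentOn 0 L x y) (D Q n : ℕ) : ∀ s, s ≤ L → L - s = n →
    (s < L → ∀ u < s, ¬ StraightOn x y u (s + 1)) →
    ∃ k, Chain (PieceOn x y L Q) k s L ∧
      Q * (D * k) ≤ 2 * Q * (L - s) + (2 * D + 5 * D ^ 2) * (L - s) + Q * (D + 5 * D ^ 2) := by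
  induction n using Nat.strong_induction_on with
  | _ n ih =>
  intro s hsL hn hinv
  by_cases hlong : ∃ t, s ≤ t ∧ t < L ∧ LongStep x y L Q t
  swap
  · push Not at hlong
    obtain ⟨k, hk, hkD⟩ := (h.mono (Nat.zero_le s) le_rfl).exists_chain hsL D
    refine ⟨k, hk.imp fun v w h1 _ h2 h3 =>
      Or.inl ⟨h3, fun i h4 h5 => hlong i (by omega) (by omega)⟩, ?_⟩
    have := Nat.mul_le_mul_left Q hkD
    have : Q * (2 * (L - s) + (D + 5 * D ^ 2)) = 2 * Q * (L - s) + Q * (D + 5 * D ^ 2) := by ring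
    omega
  · classical
    obtain ⟨hst, htL, u, v₀, hut, htv₀, hv₀L, hQ, hstr⟩ := Nat.find_spec hlong
    set t := Nat.find hlong with ht
    have hmin : ∀ i, s ≤ i → i < t → ¬ LongStep x y L Q i := fun i h1 h2 h3 =>
      Nat.find_min hlong h2 ⟨h1, by omega, h3⟩
    have hsu : s ≤ u := by
      by_contra hcon
      exact hinv (by omega) u (by omega) (hstr.mono le_rfl (by omega))
    have hut' : u = t := by
      rcases hut.eq_or_lt with h1 | h1
      · exact h1
      · exact (hmin u hsu h1 ⟨u, v₀, le_rfl, by omega, hv₀L, hQ, hstr⟩).elim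
    rw [hut'] at hstr hQ
    obtain ⟨v, hv₀v, hvL, hv, hlast⟩ := exists_last (P := fun v => StraightOn x y t v) hv₀L hstr
    obtain ⟨k, hk, hkD⟩ := ih (L - v) (by omega) v hvL rfl fun hvL' u huv hu =>
      hlast (v + 1) (by omega) (by omega) (hv.extend (by omega) hu huv)
    obtain ⟨m, hm, hmD⟩ := (h.mono (Nat.zero_le s) htL.le).exists_chain hst D
    refine ⟨m + (k + 1), (hm.imp fun v w h1 _ h2 h3 =>
      Or.inl ⟨h3, fun i h4 h5 => hmin i (by omega) (by omega)⟩).append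
      (Chain.cons (by omega) (Or.inr hv) hk), ?_⟩
    have e1 : L - s = (t - s) + (v - t) + (L - v) := by omega
    have e2 : Q ≤ v - t := by omega
    rw [e1]
    have h1 := Nat.mul_le_mul_left Q hmD
    have h2 := Nat.mul_le_mul_left (2 * D + 5 * D ^ 2) e2
    nlinarith [Nat.zero_le (Q * (v - t)), Nat.zero_le ((2 * D + 5 * D ^ 2) * (t - s))]

end PrudentOn

theorem exists_piece_scale (K M : ℕ) : ∃ Q c, K ≤ Q ∧ ∀ (L : ℕ) (x y : ℕ → ℤ),
    PrudentOn 0 L x y → ∃ k, Chain (PieceOn x y L Q) k 0 L ∧ M * k ≤ L + c := by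
  refine ⟨2 * (4 * M) + 5 * (4 * M) ^ 2 + K + 1, (4 * M) + 5 * (4 * M) ^ 2, by omega, ?_⟩
  intro L x y h
  set C := 5 * (4 * M) ^ 2 with hC
  set Q := 2 * (4 * M) + C + K + 1 with hQ
  obtain ⟨k, hk, hkD⟩ := h.exists_pieces_from (4 * M) Q L 0 (Nat.zero_le L) rfl
    (fun _ u hu => by omega)
  refine ⟨k, hk, ?_⟩
  rw [Nat.sub_zero, ← hC] at hkD
  clear_value Q C
  have h1 : (2 * (4 * M) + C) * L ≤ Q * L := Nat.mul_le_mul_right L (by omega)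
  have h2 : Q * (4 * M * k) ≤ Q * (3 * L + (4 * M + C)) := by linarith
  have h3 := Nat.le_of_mul_le_mul_left h2 (by omega)
  have h4 : 4 * M * k = 4 * (M * k) := by ring
  omega

/-! ## The energy of a piece -/

open scoped Classical in
/-- The number of steps in `[s, i)` touching step `i`. -/
noncomputable def touchCount (x y : ℕ → ℤ) (s i : ℕ) : ℕ :=
  ((Finset.Ico s i).filter fun j => Touch x y j i).card

open scoped Classical in
/-- The steps in `[s, t)` lying in straight stretches of length more than `K`, but not `Q`. -/
noncomputable def mediumSet (x y : ℕ → ℤ) (L K Q s t : ℕ) : Finset ℕ :=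
  (Finset.Ico s t).filter fun i => LongStep x y L K i ∧ ¬ LongStep x y L Q i

namespace PrudentOn

variable {L : ℕ} {x y : ℕ → ℤ}

theorem touchCount_le (h : PrudentOn 0 L x y) {i : ℕ} (hi : i < L) : touchCount x y 0 i ≤ 2 := by
  have := h.card_touch_le hi
  rwa [Finset.range_eq_Ico] at this

theorem sum_touchCount_le (h : PrudentOn 0 L x y) {s t : ℕ} (ht : t ≤ L) :
    ∑ i ∈ Finset.Ico s t, touchCount x y 0 i ≤ 2 * (t - s) := by
  have := Finset.sum_le_card_nsmul (Finset.Ico s t) (touchCount x y 0) 2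
    (fun i hi => h.touchCount_le (by have := Finset.mem_Ico.mp hi; omega))
  simpa [mul_comm] using this

/-- The touchings of the steps of a piece without long stretches, up to the touchings inside the
piece, come from the boundary effect and from the stretches of medium length. -/
theorem sum_touchCount_le_of_not_long (h : PrudentOn 0 L x y) {K Q s t : ℕ} (hK : 0 < K)
    (ht : t ≤ L) (hQ : ∀ i, s ≤ i → i < t → ¬ LongStep x y L Q i) :
    ∑ i ∈ Finset.Ico s t, touchCount x y 0 i ≤ ∑ i ∈ Finset.Ico s t, touchCount x y s i +
      (2 * (8 * K + 1) + 2 * (mediumSet x y L K Q s t).card) := by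
  classical
  have h1 : ∀ i ∈ Finset.Ico s t, touchCount x y 0 i ≤ touchCount x y s i +
      if i ∈ crossSet x y L K s ∪ mediumSet x y L K Q s t then 2 else 0 := by
    intro i hi
    have hi' := Finset.mem_Ico.mp hi
    split_ifs with hmem
    · have := h.touchCount_le (by omega : i < L); omega
    · rw [add_zero]
      refine Finset.card_le_card fun j hj => ?_
      simp only [Finset.mem_filter, Finset.mem_Ico] at hj ⊢
      refine ⟨⟨?_, hj.1.2⟩, hj.2⟩
      by_contra hcon
      refine hmem (Finset.mem_union.mpr ?_)
      by_cases hl : LongStep x y L K i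
      · exact Or.inr (Finset.mem_filter.mpr ⟨hi, hl, hQ i hi'.1 hi'.2⟩)
      · exact Or.inl (Finset.mem_filter.mpr
          ⟨Finset.mem_range.mpr (by omega), hi'.1, hl, j, by omega, hj.2⟩)
  refine (Finset.sum_le_sum h1).trans ?_
  rw [Finset.sum_add_distrib, ← Finset.sum_filter, Finset.sum_const, smul_eq_mul]
  have h2 : ((Finset.Ico s t).filter
      fun i => i ∈ crossSet x y L K s ∪ mediumSet x y L K Q s t).card ≤
      (crossSet x y L K s).card + (mediumSet x y L K Q s t).card :=
    (Finset.card_le_card fun i hi => (Finset.mem_filter.mp hi).2).trans (Finset.card_union_le _ _)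
  have h3 := h.card_crossSet_le (s := s) hK
  omega

end PrudentOn

theorem card_mediumSet_add (x y : ℕ → ℤ) (L K Q : ℕ) {s t u : ℕ} (hst : s ≤ t) (htu : t ≤ u) :
    (mediumSet x y L K Q s u).card =
      (mediumSet x y L K Q s t).card + (mediumSet x y L K Q t u).card := by
  classical
  unfold mediumSet
  rw [← Finset.Ico_union_Ico_eq_Ico hst htu, Finset.filter_union, Finset.card_union_of_disjoint]
  exact Finset.disjoint_filter_filter (Finset.Ico_disjoint_Ico_consecutive s t u)

/-- For every precision `J` there are scales `K < Q` at which a given prudent walk has few pieces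
and few steps in stretches of medium length. -/
theorem exists_good_scale (J : ℕ) (hJ : 0 < J) : ∃ C : ℕ, ∀ (L : ℕ) (x y : ℕ → ℤ),
    PrudentOn 0 L x y → ∃ K Q k, 0 < K ∧ Chain (PieceOn x y L Q) k 0 L ∧
      J * ((8 * K + 1) * k) ≤ L + C ∧ J * (mediumSet x y L K Q 0 L).card ≤ L := by
  classical
  choose Q c hKQ hQ using fun K => exists_piece_scale K (J * (8 * K + 1))
  let κ : ℕ → ℕ := fun j => Nat.rec 1 (fun _ K => Q K) j
  have hκ : ∀ j, κ (j + 1) = Q (κ j) := fun j => rfl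
  have hmono : Monotone κ := monotone_nat_of_le_succ fun j => by rw [hκ]; exact hKQ _
  refine ⟨∑ j ∈ Finset.range J, c (κ j), fun L x y h => ?_⟩
  have hdisj : ∑ j ∈ Finset.range J, (mediumSet x y L (κ j) (κ (j + 1)) 0 L).card ≤ L := by
    rw [← Finset.card_biUnion]
    · refine (Finset.card_le_card (t := Finset.Ico 0 L) ?_).trans (by simp)
      intro i hi
      obtain ⟨j, _, hj⟩ := Finset.mem_biUnion.mp hi
      exact (Finset.mem_filter.mp hj).1
    · have key : ∀ j l, j < l → Disjoint (mediumSet x y L (κ j) (κ (j + 1)) 0 L)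
          (mediumSet x y L (κ l) (κ (l + 1)) 0 L) := by
        intro j l hjl
        refine Finset.disjoint_left.mpr fun i hi hi' => ?_
        exact (Finset.mem_filter.mp hi).2.2
          ((Finset.mem_filter.mp hi').2.1.anti (hmono (Nat.succ_le_of_lt hjl)))
      intro j _ l _ hne
      rcases Nat.lt_or_gt_of_ne hne with hlt | hlt
      · exact key j l hlt
      · exact (key l j hlt).symm
  obtain ⟨j, hj, hjm⟩ := Finset.exists_min_image (Finset.range J)
    (fun j => (mediumSet x y L (κ j) (κ (j + 1)) 0 L).card) ⟨0, Finset.mem_range.mpr hJ⟩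
  obtain ⟨k, hk, hkJ⟩ := hQ (κ j) L x y h
  refine ⟨κ j, κ (j + 1), k, ?_, hk, ?_, ?_⟩
  · exact lt_of_lt_of_le Nat.one_pos (hmono (Nat.zero_le j))
  · rw [← mul_assoc]
    exact hkJ.trans (Nat.add_le_add_left
      (Finset.single_le_sum (f := fun j => c (κ j)) (fun _ _ => Nat.zero_le _) hj) L)
  · have := Finset.card_nsmul_le_sum (Finset.range J) _ _ hjm
    rw [Finset.card_range, smul_eq_mul] at this
    exact this.trans hdisj

/-! ## Coordinates of a step list -/

/-- First coordinate of the path with given steps. -/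
def pathX (l : List (ℤ × ℤ)) (i : ℕ) : ℤ := (pt l i).1

/-- Second coordinate of the path with given steps. -/
def pathY (l : List (ℤ × ℤ)) (i : ℕ) : ℤ := (pt l i).2

/-- All steps are unit steps. -/
def UnitSteps (l : List (ℤ × ℤ)) : Prop := ∀ d ∈ l, ∃ k, d = dirs k

theorem dirs_cases (k : Fin 4) :
    dirs k = (1, 0) ∨ dirs k = (-1, 0) ∨ dirs k = (0, 1) ∨ dirs k = (0, -1) := by
  fin_cases k <;> simp [dirs]

theorem UnitSteps.cases {l : List (ℤ × ℤ)} (h : UnitSteps l) {d : ℤ × ℤ} (hd : d ∈ l) :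
    d = (1, 0) ∨ d = (-1, 0) ∨ d = (0, 1) ∨ d = (0, -1) := by
  obtain ⟨k, rfl⟩ := h d hd
  exact dirs_cases k

theorem pt_succ (l : List (ℤ × ℤ)) {i : ℕ} (hi : i < l.length) :
    pt l (i + 1) = pt l i + l[i] := by
  unfold pt
  rw [← List.take_concat_get' l i hi, List.sum_append, List.sum_singleton]

theorem pathX_succ (l : List (ℤ × ℤ)) {i : ℕ} (hi : i < l.length) :
    pathX l (i + 1) = pathX l i + l[i].1 := by
  simp [pathX, pt_succ l hi]

theorem pathY_succ (l : List (ℤ × ℤ)) {i : ℕ} (hi : i < l.length) :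
    pathY l (i + 1) = pathY l i + l[i].2 := by
  simp [pathY, pt_succ l hi]

theorem isPrudent_iff {l : List (ℤ × ℤ)} (h : UnitSteps l) :
    IsPrudent l ↔ PrudentOn 0 l.length (pathX l) (pathY l) := by
  have hstep : ∀ i, (hi : i < l.length) →
      (l[i] = (1, 0) ∨ l[i] = (-1, 0) ∨ l[i] = (0, 1) ∨ l[i] = (0, -1)) :=
    fun i hi => h.cases (List.getElem_mem hi)
  have hget : ∀ i, (hi : i < l.length) → l.getD i (0, 0) = l[i] := fun i hi =>
    List.getD_eq_getElem l (0, 0) hi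
  constructor
  · intro hp
    have key : ∀ i j, j ≤ i → (hi : i < l.length) → ∀ k : ℕ, 1 ≤ k →
        pathX l i + k * l[i].1 = pathX l j → pathY l i + k * l[i].2 = pathY l j → False := by
      intro i j hj hi k hk hx hy
      refine hp i hi k hk j hj ?_
      rw [hget i hi]
      ext
      · simpa [pathX] using hx
      · simpa [pathY] using hy
    constructor
    · intro i _ hi
      rw [pathX_succ l hi, pathY_succ l hi]
      rcases hstep i hi with h1 | h1 | h1 | h1 <;> rw [h1] <;> simp [sub_eq_add_neg]
    all_goals
      intro i j _ hj hi h1 h2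
      by_contra hcon
    · rw [pathX_succ l hi] at h1
      have h3 : l[i] = (1, 0) := by
        rcases hstep i hi with h3 | h3 | h3 | h3 <;> rw [h3] at h1 ⊢ <;> simp at h1
      refine key i j hj hi (pathX l j - pathX l i).toNat (by omega) ?_ ?_ <;> rw [h3] <;> simp <;>
        omega
    · rw [pathX_succ l hi] at h1
      have h3 : l[i] = (-1, 0) := by
        rcases hstep i hi with h3 | h3 | h3 | h3 <;> rw [h3] at h1 ⊢ <;> simp at h1 <;> omega
      refine key i j hj hi (pathX l i - pathX l j).toNat (by omega) ?_ ?_ <;> rw [h3] <;> simp <;>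
        omega
    · rw [pathY_succ l hi] at h1
      have h3 : l[i] = (0, 1) := by
        rcases hstep i hi with h3 | h3 | h3 | h3 <;> rw [h3] at h1 ⊢ <;> simp at h1
      refine key i j hj hi (pathY l j - pathY l i).toNat (by omega) ?_ ?_ <;> rw [h3] <;> simp <;>
        omega
    · rw [pathY_succ l hi] at h1
      have h3 : l[i] = (0, -1) := by
        rcases hstep i hi with h3 | h3 | h3 | h3 <;> rw [h3] at h1 ⊢ <;> simp at h1 <;> omega
      refine key i j hj hi (pathY l i - pathY l j).toNat (by omega) ?_ ?_ <;> rw [h3] <;> simp <;>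
        omega
  · intro hp i hi k hk j hj heq
    rw [hget i hi] at heq
    have hx : pathX l i + k * l[i].1 = pathX l j := by
      have := congrArg Prod.fst heq; simpa [pathX] using this
    have hy : pathY l i + k * l[i].2 = pathY l j := by
      have := congrArg Prod.snd heq; simpa [pathY] using this
    have hX := pathX_succ l hi
    have hY := pathY_succ l hi
    rcases hstep i hi with h1 | h1 | h1 | h1 <;> rw [h1] at hx hy hX hY <;>
      simp only [mul_one, mul_zero, mul_neg, add_zero] at hx hy hX hY
    · have := hp.right i j (Nat.zero_le _) hj hi hX (by omega); omega
    · have := hp.left i j (Nat.zero_le _) hj hi hX (by omega); omega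
    · have := hp.up i j (Nat.zero_le _) hj hi hY (by omega); omega
    · have := hp.down i j (Nat.zero_le _) hj hi hY (by omega); omega

theorem Ham_eq_sum (l : List (ℤ × ℤ)) :
    Ham l = ∑ i ∈ Finset.range l.length, touchCount (pathX l) (pathY l) 0 i := by
  classical
  unfold Ham touchCount
  rw [← Finset.card_sigma]
  refine Finset.card_bij' (fun p _ => ⟨p.2, p.1⟩) (fun p _ => (p.2, p.1)) ?_ ?_ ?_ ?_
  · rintro ⟨j, i⟩ hp
    simp only [Finset.mem_filter, Finset.mem_product, Finset.mem_range] at hp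
    simp only [Finset.mem_sigma, Finset.mem_range, Finset.mem_filter, Finset.mem_Ico]
    exact ⟨hp.1.2, ⟨Nat.zero_le _, hp.2.1⟩, hp.2.2⟩
  · rintro ⟨i, j⟩ hp
    simp only [Finset.mem_sigma, Finset.mem_range, Finset.mem_filter, Finset.mem_Ico] at hp
    simp only [Finset.mem_filter, Finset.mem_product, Finset.mem_range]
    exact ⟨⟨by omega, hp.1⟩, hp.2.1.2, hp.2.2⟩
  · intros; rfl
  · intros; rfl

/-! ## Transfer between a path and its pieces -/

/-- On a time interval of length `n` the walk `x', y'` is a translate of `x, y` from time `s`. -/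
def TranslateOn (x y x' y' : ℕ → ℤ) (s n : ℕ) : Prop :=
  ∃ c d : ℤ, ∀ i ≤ n, x' i = x (s + i) - c ∧ y' i = y (s + i) - d

namespace TranslateOn

variable {x y x' y' : ℕ → ℤ} {s n : ℕ}

theorem swap (h : TranslateOn x y x' y' s n) : TranslateOn y x y' x' s n := by
  obtain ⟨c, d, h⟩ := h
  exact ⟨d, c, fun i hi => (h i hi).symm⟩

theorem negX (h : TranslateOn x y x' y' s n) : TranslateOn (-x) y (-x') y' s n := by
  obtain ⟨c, d, h⟩ := h
  exact ⟨-c, d, fun i hi => by have := h i hi; simp only [Pi.neg_apply]; omega⟩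

theorem prudentOn_iff (h : TranslateOn x y x' y' s n) :
    PrudentOn 0 n x' y' ↔ PrudentOn s (s + n) x y := by
  obtain ⟨c, d, h⟩ := h
  have h' : ∀ i, s ≤ i → i ≤ s + n → x i = x' (i - s) + c ∧ y i = y' (i - s) + d := by
    intro i h1 h2
    have := h (i - s) (by omega)
    rw [show s + (i - s) = i by omega] at this
    omega
  constructor
  · intro hp
    constructor
    · intro i h1 h2
      have h3 := hp.step (i - s) (Nat.zero_le _) (by omega)
      have h4 := h' i h1 (by omega)
      have h5 := h' (i + 1) (by omega) (by omega)
      rw [show i + 1 - s = i - s + 1 by omega] at h5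
      omega
    all_goals
      intro i j h1 h2 h3 h4 h5
      have h6 := h' i (by omega) (by omega)
      have h7 := h' (i + 1) (by omega) (by omega)
      have h8 := h' j (by omega) (by omega)
      rw [show i + 1 - s = i - s + 1 by omega] at h7
    · have := hp.right (i - s) (j - s) (Nat.zero_le _) (by omega) (by omega) (by omega) (by omega)
      omega
    · have := hp.left (i - s) (j - s) (Nat.zero_le _) (by omega) (by omega) (by omega) (by omega)
      omega
    · have := hp.up (i - s) (j - s) (Nat.zero_le _) (by omega) (by omega) (by omega) (by omega)
      omega
    · have := hp.down (i - s) (j - s) (Nat.zero_le _) (by omega) (by omega) (by omega) (by omega)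
      omega
  · intro hp
    constructor
    · intro i h1 h2
      have h3 := hp.step (s + i) (by omega) (by omega)
      have h4 := h i (by omega)
      have h5 := h (i + 1) (by omega)
      rw [← add_assoc] at h5
      omega
    all_goals
      intro i j h1 h2 h3 h4 h5
      have h6 := h i (by omega)
      have h7 := h (i + 1) (by omega)
      have h8 := h j (by omega)
      rw [← add_assoc] at h7
    · have := hp.right (s + i) (s + j) (by omega) (by omega) (by omega) (by omega) (by omega)
      omega
    · have := hp.left (s + i) (s + j) (by omega) (by omega) (by omega) (by omega) (by omega)
      omega
    · have := hp.up (s + i) (s + j) (by omega) (by omega) (by omega) (by omega) (by omega)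
      omega
    · have := hp.down (s + i) (s + j) (by omega) (by omega) (by omega) (by omega) (by omega)
      omega

theorem cornerOn_iff (h : TranslateOn x y x' y' s n) :
    CornerOn x' y' 0 n ↔ CornerOn x y s (s + n) := by
  obtain ⟨c, d, h⟩ := h
  have h' : ∀ i, s ≤ i → i ≤ s + n → x i = x' (i - s) + c ∧ y i = y' (i - s) + d := by
    intro i h1 h2
    have := h (i - s) (by omega)
    rw [show s + (i - s) = i by omega] at this
    omega
  constructor
  · rintro ⟨c1, c2, c3⟩
    refine ⟨fun i j h1 h2 h3 h4 => ?_, fun i j h1 h2 h3 h4 => ?_, fun j h1 h2 => ?_⟩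
    iterate 2
      have h6 := h' i (by omega) (by omega)
      have h7 := h' (i + 1) (by omega) (by omega)
      have h8 := h' j (by omega) (by omega)
      rw [show i + 1 - s = i - s + 1 by omega] at h7
      have e1 := c1 (i - s) (j - s) (Nat.zero_le _) (by omega) (by omega)
      have e2 := c2 (i - s) (j - s) (Nat.zero_le _) (by omega) (by omega)
      omega
    · have h6 := h' j h1 h2
      have h7 := h' (s + n) (by omega) le_rfl
      rw [Nat.add_sub_cancel_left] at h7
      have := c3 (j - s) (Nat.zero_le _) (by omega)
      omega
  · rintro ⟨c1, c2, c3⟩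
    refine ⟨fun i j h1 h2 h3 h4 => ?_, fun i j h1 h2 h3 h4 => ?_, fun j h1 h2 => ?_⟩
    iterate 2
      have h6 := h i (by omega)
      have h7 := h (i + 1) (by omega)
      have h8 := h j (by omega)
      rw [← add_assoc] at h7
      have e1 := c1 (s + i) (s + j) (by omega) (by omega) (by omega)
      have e2 := c2 (s + i) (s + j) (by omega) (by omega) (by omega)
      omega
    · have h6 := h j h2
      have h7 := h n le_rfl
      have := c3 (s + j) (by omega) (by omega)
      omega

theorem touch_iff (h : TranslateOn x y x' y' s n) {i j : ℕ} (hi : i < n) (hj : j < n) :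
    Touch x' y' j i ↔ Touch x y (s + j) (s + i) := by
  obtain ⟨c, d, h⟩ := h
  unfold Touch
  have h1 := h i hi.le
  have h2 := h j hj.le
  have h3 := h (i + 1) hi
  have h4 := h (j + 1) hj
  rw [h1.1, h1.2, h2.1, h2.2, h3.1, h3.2, h4.1, h4.2, ← add_assoc, ← add_assoc]
  ring_nf

theorem touchCount_eq (h : TranslateOn x y x' y' s n) {i : ℕ} (hi : i < n) :
    touchCount x' y' 0 i = touchCount x y s (s + i) := by
  classical
  unfold touchCount
  refine Finset.card_bij' (fun j _ => s + j) (fun j _ => j - s) ?_ ?_ ?_ ?_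
  · intro j hj
    simp only [Finset.mem_filter, Finset.mem_Ico] at hj ⊢
    exact ⟨by omega, (h.touch_iff hi (by omega)).mp hj.2⟩
  · intro j hj
    simp only [Finset.mem_filter, Finset.mem_Ico] at hj ⊢
    refine ⟨by omega, (h.touch_iff hi (by omega)).mpr ?_⟩
    rw [show s + (j - s) = j by omega]
    exact hj.2
  · intros; simp
  · intro j hj
    simp only [Finset.mem_filter, Finset.mem_Ico] at hj
    omega

theorem sum_touchCount_eq (h : TranslateOn x y x' y' s n) :
    ∑ i ∈ Finset.range n, touchCount x' y' 0 i =
      ∑ i ∈ Finset.Ico s (s + n), touchCount x y s i := by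
  rw [Finset.sum_Ico_eq_sum_range, Nat.add_sub_cancel_left]
  exact Finset.sum_congr rfl fun i hi => h.touchCount_eq (Finset.mem_range.mp hi)

end TranslateOn

theorem pt_drop (l : List (ℤ × ℤ)) (s i : ℕ) : pt (l.drop s) i = pt l (s + i) - pt l s := by
  unfold pt
  rw [List.take_add, List.sum_append]
  simp

/-- The middle part of a concatenation is a translate of a part of the whole path. -/
theorem translateOn_append (p q r : List (ℤ × ℤ)) :
    TranslateOn (pathX (p ++ q ++ r)) (pathY (p ++ q ++ r)) (pathX q) (pathY q) p.length
      q.length := by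
  refine ⟨pathX (p ++ q ++ r) p.length, pathY (p ++ q ++ r) p.length, fun i hi => ?_⟩
  have h1 : pt q i = pt (p ++ q ++ r) (p.length + i) - pt (p ++ q ++ r) p.length := by
    rw [← pt_drop, List.append_assoc, List.drop_left]
    unfold pt
    rw [List.take_append_of_le_length hi]
  constructor
  · simpa [pathX] using congrArg Prod.fst h1
  · simpa [pathY] using congrArg Prod.snd h1

/-! ## Gluing corner pieces -/

/-- A prudent corner piece whose first step is not a left step. -/
structure CorOn (x y : ℕ → ℤ) (s t : ℕ) : Prop where
  prudent : PrudentOn s t x y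
  corner : CornerOn x y s t
  first : s < t → x (s + 1) ≠ x s - 1

theorem TranslateOn.corOn_iff {x y x' y' : ℕ → ℤ} {s n : ℕ} (h : TranslateOn x y x' y' s n) :
    CorOn x' y' 0 n ↔ CorOn x y s (s + n) := by
  have key : (0 < n → x' (0 + 1) ≠ x' 0 - 1) ↔ (s < s + n → x (s + 1) ≠ x s - 1) := by
    obtain ⟨c, d, h⟩ := h
    have h1 := h 0 (Nat.zero_le n)
    rw [add_zero] at h1
    constructor
    · intro h2 h3
      have h4 := h 1 (by omega)
      have h5 := h2 (by omega)
      rw [zero_add] at h5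
      omega
    · intro h2 h3
      have h4 := h 1 (by omega)
      have h5 := h2 (by omega)
      rw [zero_add]
      omega
  constructor
  · rintro ⟨h1, h2, h3⟩
    exact ⟨h.prudentOn_iff.mp h1, h.cornerOn_iff.mp h2, key.mp h3⟩
  · rintro ⟨h1, h2, h3⟩
    exact ⟨h.prudentOn_iff.mpr h1, h.cornerOn_iff.mpr h2, key.mpr h3⟩

namespace CorOn

variable {x y : ℕ → ℤ} {s t : ℕ}

theorem above_of_left (h : CorOn x y s t) {i : ℕ} (hsi : s ≤ i) (hit : i ≤ t)
    (hx : x i < x s) : y s < y i := by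
  induction i, hsi using Nat.le_induction with
  | base => omega
  | succ n hn ih =>
    have h1 := h.prudent.step n hn (by omega)
    by_cases hxn : x n < x s
    · have h2 := ih (by omega) hxn
      have h3 := h.corner.2.1 n s le_rfl hn (by omega)
      omega
    · have h2 : x (n + 1) = x n - 1 := by omega
      have h3 := h.corner.1 n s le_rfl hn (by omega) h2
      rcases hn.eq_or_lt with rfl | hlt
      · exact (h.first (by omega) h2).elim
      · have h4 : y s ≠ y n := fun h5 =>
          h.prudent.ne_of_lt le_rfl hlt (by omega) (by omega) h5
        omega

theorem above_of_left_step (h : CorOn x y s t) {i : ℕ} (hsi : s ≤ i) (hit : i < t)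
    (hx : x (i + 1) = x i - 1) : y s < y i := by
  have h1 := h.corner.1 i s le_rfl hsi hit hx
  rcases hsi.eq_or_lt with rfl | hlt
  · exact (h.first hit hx).elim
  · by_contra hcon
    have h2 : y s = y i := by omega
    have h3 := h.prudent.left i s le_rfl hsi hit hx h2
    rcases h3.eq_or_lt with h4 | h4
    · exact h.prudent.ne_of_lt le_rfl hlt hit.le h4.symm h2
    · have := h.above_of_left hsi hit.le h4
      omega

/-- Two corner pieces joined by an up step and a right step form a corner piece. -/
theorem glue {a n b : ℕ} (han : a ≤ n) (h : CorOn x y a n) (h' : CorOn x y (n + 2) b)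
    (hnb : n + 2 ≤ b) (hU : x (n + 1) = x n ∧ y (n + 1) = y n + 1)
    (hR : x (n + 2) = x (n + 1) + 1 ∧ y (n + 2) = y (n + 1)) : CorOn x y a b := by
  -- the past of the second piece
  have hpast : ∀ j, a ≤ j → j < n + 2 → x j < x (n + 2) ∧ y j ≤ y (n + 2) ∧
      (j ≤ n → y j < y (n + 2)) := by
    intro j h1 h2
    by_cases hj : j ≤ n
    · have := h.corner.2.2 j h1 hj; omega
    · obtain rfl : j = n + 1 := by omega
      omega
  have hend := h'.corner.2.2 (n + 2) le_rfl hnb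
  refine ⟨⟨fun i h1 h2 => ?_, fun i j h1 h2 h3 h4 h5 => ?_, fun i j h1 h2 h3 h4 h5 => ?_,
    fun i j h1 h2 h3 h4 h5 => ?_, fun i j h1 h2 h3 h4 h5 => ?_⟩, ⟨fun i j h1 h2 h3 h4 => ?_,
    fun i j h1 h2 h3 h4 => ?_, fun j h1 h2 => ?_⟩, fun h1 => ?_⟩
  · by_cases hi : i < n
    · exact h.prudent.step i h1 hi
    by_cases hi' : n + 2 ≤ i
    · exact h'.prudent.step i hi' h2
    obtain rfl | rfl : i = n ∨ i = n + 1 := by omega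
    · omega
    · rw [show n + 1 + 1 = n + 2 from rfl]; omega
  · by_cases hi : i < n
    · exact h.prudent.right i j h1 h2 hi h4 h5
    by_cases hi' : n + 2 ≤ i
    · by_cases hj : n + 2 ≤ j
      · exact h'.prudent.right i j hj h2 h3 h4 h5
      · have e1 := hpast j h1 (by omega)
        have e2 := h'.above_of_left hi' h3.le
        omega
    · have e := h.corner.2.2 j h1
      obtain rfl | rfl : i = n ∨ i = n + 1 := by omega
      · omega
      · obtain hj | rfl : j ≤ n ∨ j = n + 1 := by omega
        · have := e hj; omega
        · omega
  · by_cases hi : i < n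
    · exact h.prudent.left i j h1 h2 hi h4 h5
    by_cases hi' : n + 2 ≤ i
    · by_cases hj : n + 2 ≤ j
      · exact h'.prudent.left i j hj h2 h3 h4 h5
      · have e1 := hpast j h1 (by omega)
        have e2 := h'.above_of_left_step hi' h3 h4
        omega
    · obtain rfl | rfl : i = n ∨ i = n + 1 := by omega
      · omega
      · rw [show n + 1 + 1 = n + 2 from rfl] at h4; omega
  · by_cases hi : i < n
    · exact h.prudent.up i j h1 h2 hi h4 h5
    by_cases hi' : n + 2 ≤ i
    · by_cases hj : n + 2 ≤ j
      · exact h'.prudent.up i j hj h2 h3 h4 h5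
      · have e1 := hpast j h1 (by omega)
        have e2 := h'.above_of_left hi' h3.le
        omega
    · obtain rfl | rfl : i = n ∨ i = n + 1 := by omega
      · exact (h.corner.2.2 j h1 h2).2
      · rw [show n + 1 + 1 = n + 2 from rfl] at h4; omega
  · by_cases hi : i < n
    · exact h.prudent.down i j h1 h2 hi h4 h5
    by_cases hi' : n + 2 ≤ i
    · by_cases hj : n + 2 ≤ j
      · exact h'.prudent.down i j hj h2 h3 h4 h5
      · have e1 := hpast j h1 (by omega)
        have e2 := h'.corner.2.1 i (n + 2) le_rfl hi' h3 h4
        omega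
    · obtain rfl | rfl : i = n ∨ i = n + 1 := by omega
      · omega
      · rw [show n + 1 + 1 = n + 2 from rfl] at h4; omega
  · by_cases hi : i < n
    · exact h.corner.1 i j h1 h2 hi h4
    by_cases hi' : n + 2 ≤ i
    · by_cases hj : n + 2 ≤ j
      · exact h'.corner.1 i j hj h2 h3 h4
      · have e1 := hpast j h1 (by omega)
        have e2 := h'.corner.1 i (n + 2) le_rfl hi' h3 h4
        omega
    · obtain rfl | rfl : i = n ∨ i = n + 1 := by omega
      · omega
      · rw [show n + 1 + 1 = n + 2 from rfl] at h4; omega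
  · by_cases hi : i < n
    · exact h.corner.2.1 i j h1 h2 hi h4
    by_cases hi' : n + 2 ≤ i
    · by_cases hj : n + 2 ≤ j
      · exact h'.corner.2.1 i j hj h2 h3 h4
      · have e1 := hpast j h1 (by omega)
        have e2 := h'.corner.2.1 i (n + 2) le_rfl hi' h3 h4
        omega
    · obtain rfl | rfl : i = n ∨ i = n + 1 := by omega
      · omega
      · rw [show n + 1 + 1 = n + 2 from rfl] at h4; omega
  · by_cases hj : n + 2 ≤ j
    · exact h'.corner.2.2 j hj h2
    · have := hpast j h1 (by omega); omega
  · rcases han.eq_or_lt with rfl | hlt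
    · omega
    · exact h.first hlt

/-- A corner piece followed by an up step is a corner piece. -/
theorem snoc_up {a n : ℕ} (han : a ≤ n) (h : CorOn x y a n)
    (hU : x (n + 1) = x n ∧ y (n + 1) = y n + 1) : CorOn x y a (n + 1) := by
  refine ⟨⟨fun i h1 h2 => ?_, fun i j h1 h2 h3 h4 h5 => ?_, fun i j h1 h2 h3 h4 h5 => ?_,
    fun i j h1 h2 h3 h4 h5 => ?_, fun i j h1 h2 h3 h4 h5 => ?_⟩, ⟨fun i j h1 h2 h3 h4 => ?_,
    fun i j h1 h2 h3 h4 => ?_, fun j h1 h2 => ?_⟩, fun h1 => ?_⟩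
  · obtain hi | rfl : i < n ∨ i = n := by omega
    · exact h.prudent.step i h1 hi
    · omega
  · obtain hi | rfl : i < n ∨ i = n := by omega
    · exact h.prudent.right i j h1 h2 hi h4 h5
    · omega
  · obtain hi | rfl : i < n ∨ i = n := by omega
    · exact h.prudent.left i j h1 h2 hi h4 h5
    · omega
  · obtain hi | rfl : i < n ∨ i = n := by omega
    · exact h.prudent.up i j h1 h2 hi h4 h5
    · exact (h.corner.2.2 j h1 h2).2
  · obtain hi | rfl : i < n ∨ i = n := by omega
    · exact h.prudent.down i j h1 h2 hi h4 h5
    · omega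
  · obtain hi | rfl : i < n ∨ i = n := by omega
    · exact h.corner.1 i j h1 h2 hi h4
    · omega
  · obtain hi | rfl : i < n ∨ i = n := by omega
    · exact h.corner.2.1 i j h1 h2 hi h4
    · omega
  · obtain hi | rfl : j ≤ n ∨ j = n + 1 := by omega
    · have := h.corner.2.2 j h1 hi; omega
    · exact ⟨le_rfl, le_rfl⟩
  · rcases han.eq_or_lt with rfl | hlt
    · omega
    · exact h.first hlt

end CorOn

/-! ## Sums over step lists -/

/-- The sum of `f` over all lists of `n` unit steps. -/
noncomputable def pathSum : (List (ℤ × ℤ) → ℝ) → ℕ → ℝ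
  | f, 0 => f []
  | f, n + 1 => ∑ d : Fin 4, pathSum (fun l => f (dirs d :: l)) n

theorem pathSum_eq (f : List (ℤ × ℤ) → ℝ) (n : ℕ) :
    pathSum f n = ∑ s : Fin n → Fin 4, f (stepsOf s) := by
  induction n generalizing f with
  | zero => simp [pathSum, stepsOf]
  | succ n ih =>
    rw [pathSum, ← (Fin.consEquiv fun _ : Fin (n + 1) => Fin 4).sum_comp, Fintype.sum_prod_type]
    refine Finset.sum_congr rfl fun d _ => ?_
    rw [ih]
    refine Finset.sum_congr rfl fun s _ => ?_
    simp [stepsOf, Fin.consEquiv, List.ofFn_succ]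

theorem UnitSteps.nil : UnitSteps [] := fun d hd => by simp at hd

theorem UnitSteps.cons {l : List (ℤ × ℤ)} (k : Fin 4) (h : UnitSteps l) :
    UnitSteps (dirs k :: l) := by
  intro d hd
  rcases List.mem_cons.mp hd with rfl | hd
  · exact ⟨k, rfl⟩
  · exact h d hd

theorem UnitSteps.append {p q : List (ℤ × ℤ)} (hp : UnitSteps p) (hq : UnitSteps q) :
    UnitSteps (p ++ q) := fun d hd => (List.mem_append.mp hd).elim (hp d) (hq d)

theorem UnitSteps.left {p q : List (ℤ × ℤ)} (h : UnitSteps (p ++ q)) : UnitSteps p :=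
  fun d hd => h d (List.mem_append_left q hd)

theorem UnitSteps.right {p q : List (ℤ × ℤ)} (h : UnitSteps (p ++ q)) : UnitSteps q :=
  fun d hd => h d (List.mem_append_right p hd)

theorem pathSum_mono {f g : List (ℤ × ℤ) → ℝ} {n : ℕ}
    (h : ∀ l, UnitSteps l → l.length = n → f l ≤ g l) : pathSum f n ≤ pathSum g n := by
  induction n generalizing f g with
  | zero => exact h [] UnitSteps.nil rfl
  | succ n ih =>
    refine Finset.sum_le_sum fun d _ => ih fun l hl hn => ?_
    exact h _ (hl.cons d) (by simp [hn])

theorem pathSum_congr {f g : List (ℤ × ℤ) → ℝ} {n : ℕ}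
    (h : ∀ l, UnitSteps l → l.length = n → f l = g l) : pathSum f n = pathSum g n :=
  le_antisymm (pathSum_mono fun l h1 h2 => (h l h1 h2).le)
    (pathSum_mono fun l h1 h2 => (h l h1 h2).ge)

theorem pathSum_const_mul (c : ℝ) (f : List (ℤ × ℤ) → ℝ) (n : ℕ) :
    pathSum (fun l => c * f l) n = c * pathSum f n := by
  rw [pathSum_eq, pathSum_eq, Finset.mul_sum]

theorem pathSum_mul_const (c : ℝ) (f : List (ℤ × ℤ) → ℝ) (n : ℕ) :
    pathSum (fun l => f l * c) n = pathSum f n * c := by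
  rw [pathSum_eq, pathSum_eq, Finset.sum_mul]

theorem pathSum_add (f g : List (ℤ × ℤ) → ℝ) (n : ℕ) :
    pathSum (fun l => f l + g l) n = pathSum f n + pathSum g n := by
  simp only [pathSum_eq, Finset.sum_add_distrib]

theorem pathSum_finset_sum {ι : Type*} (A : Finset ι) (f : ι → List (ℤ × ℤ) → ℝ) (n : ℕ) :
    pathSum (fun l => ∑ a ∈ A, f a l) n = ∑ a ∈ A, pathSum (f a) n := by
  simp only [pathSum_eq]
  exact Finset.sum_comm

theorem pathSum_nonneg {f : List (ℤ × ℤ) → ℝ} (hf : ∀ l, 0 ≤ f l) (n : ℕ) : 0 ≤ pathSum f n := by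
  rw [pathSum_eq]
  exact Finset.sum_nonneg fun s _ => hf _

theorem le_pathSum {f : List (ℤ × ℤ) → ℝ} (hf : ∀ l, 0 ≤ f l) {l : List (ℤ × ℤ)}
    (hl : UnitSteps l) : f l ≤ pathSum f l.length := by
  induction l generalizing f with
  | nil => exact le_rfl
  | cons d l ih =>
    obtain ⟨k, rfl⟩ := hl d List.mem_cons_self
    have h1 := ih (f := fun l => f (dirs k :: l)) (fun l => hf _)
      (fun e he => hl e (List.mem_cons_of_mem _ he))
    refine h1.trans ?_
    exact Finset.single_le_sum (f := fun d => pathSum (fun l => f (dirs d :: l)) l.length)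
      (fun d _ => pathSum_nonneg (fun l => hf _) _) (Finset.mem_univ k)

theorem pathSum_append (f : List (ℤ × ℤ) → ℝ) (m n : ℕ) :
    pathSum f (m + n) = pathSum (fun p => pathSum (fun q => f (p ++ q)) n) m := by
  induction m generalizing f with
  | zero => simp [pathSum]
  | succ m ih =>
    rw [Nat.succ_add_eq_add_succ, Nat.add_succ]
    simp only [pathSum, ih, List.cons_append]

theorem pathSum_mul_pathSum (f g : List (ℤ × ℤ) → ℝ) (m n : ℕ) :
    pathSum f m * pathSum g n = pathSum (fun p => pathSum (fun q => f p * g q) n) m := by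
  simp only [pathSum_const_mul, pathSum_mul_const]

theorem pathSum_map {σ : ℤ × ℤ → ℤ × ℤ} (e : Equiv.Perm (Fin 4)) (he : ∀ k, σ (dirs k) = dirs (e k))
    (f : List (ℤ × ℤ) → ℝ) (n : ℕ) : pathSum (fun l => f (l.map σ)) n = pathSum f n := by
  induction n generalizing f with
  | zero => simp [pathSum]
  | succ n ih =>
    simp only [pathSum, List.map_cons, he]
    refine (Finset.sum_congr rfl fun d _ => ih (fun l => f (dirs (e d) :: l))).trans ?_
    exact Equiv.sum_comp e (fun d => pathSum (fun l => f (dirs d :: l)) n)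

/-! ## The partition function of corner pieces -/

/-- A path which as a whole is a corner piece. -/
def Cor (p : List (ℤ × ℤ)) : Prop := CorOn (pathX p) (pathY p) 0 p.length

open scoped Classical in
/-- The Boltzmann weight of a corner piece. -/
noncomputable def corWeight (β : ℝ) (p : List (ℤ × ℤ)) : ℝ :=
  if Cor p then Real.exp (β * Ham p) else 0

/-- The partition function of corner pieces. -/
noncomputable def Zcor (β : ℝ) (n : ℕ) : ℝ := pathSum (corWeight β) n

theorem corWeight_nonneg (β : ℝ) (p : List (ℤ × ℤ)) : 0 ≤ corWeight β p := by
  unfold corWeight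
  split_ifs
  · exact (Real.exp_pos _).le
  · exact le_rfl

theorem corWeight_of_cor (β : ℝ) {p : List (ℤ × ℤ)} (h : Cor p) :
    corWeight β p = Real.exp (β * Ham p) := if_pos h

theorem Ham_nil : Ham [] = 0 := by simp [Ham]

theorem Ham_append_le (p r q : List (ℤ × ℤ)) : Ham p + Ham q ≤ Ham (p ++ r ++ q) := by
  have h1 := (translateOn_append [] p (r ++ q)).sum_touchCount_eq
  have h2 := (translateOn_append (p ++ r) q []).sum_touchCount_eq
  simp only [List.nil_append, List.append_nil, List.length_nil, zero_add] at h1 h2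
  rw [← List.append_assoc] at h1
  rw [Ham_eq_sum, Ham_eq_sum, Ham_eq_sum, h1, h2, Finset.range_eq_Ico,
    ← Finset.sum_Ico_consecutive _ (Nat.zero_le p.length)
      (by simp : p.length ≤ (p ++ r ++ q).length)]
  refine Nat.add_le_add_left ?_ _
  rw [List.length_append (as := p ++ r) (bs := q)]
  refine (Finset.sum_le_sum fun i hi => ?_).trans (Finset.sum_le_sum_of_subset
    (Finset.Ico_subset_Ico_left (by simp : p.length ≤ (p ++ r).length)))
  refine Finset.card_le_card fun j hj => ?_
  simp only [Finset.mem_filter, Finset.mem_Ico] at hj ⊢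
  exact ⟨⟨Nat.zero_le _, hj.1.2⟩, hj.2⟩

theorem cor_nil : Cor [] := by
  refine ⟨⟨?_, ?_, ?_, ?_, ?_⟩, ⟨?_, ?_, ?_⟩, ?_⟩
  all_goals simp

theorem pathX_append (p q : List (ℤ × ℤ)) (d : ℤ × ℤ) :
    pathX (p ++ d :: q) (p.length + 1) = pathX (p ++ d :: q) p.length + d.1 := by
  rw [pathX_succ _ (by simp)]; simp

theorem pathY_append (p q : List (ℤ × ℤ)) (d : ℤ × ℤ) :
    pathY (p ++ d :: q) (p.length + 1) = pathY (p ++ d :: q) p.length + d.2 := by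
  rw [pathY_succ _ (by simp)]; simp

theorem Cor.glue {p q : List (ℤ × ℤ)} (hp : Cor p) (hq : Cor q) :
    Cor (p ++ [(0, 1), (1, 0)] ++ q) := by
  have h1 := (translateOn_append [] p ([(0, 1), (1, 0)] ++ q)).corOn_iff.mp hp
  have h2 := (translateOn_append (p ++ [(0, 1), (1, 0)]) q []).corOn_iff.mp hq
  simp only [List.nil_append, List.append_nil, List.length_nil, zero_add] at h1 h2
  rw [← List.append_assoc] at h1
  have e1 : (p ++ [(0, 1), (1, 0)] : List (ℤ × ℤ)).length = p.length + 2 := by simp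
  rw [e1] at h2
  have h3 := pathX_append p ((1, 0) :: q) (0, 1)
  have h4 := pathY_append p ((1, 0) :: q) (0, 1)
  have h5 := pathX_append (p ++ [(0, 1)]) q (1, 0)
  have h6 := pathY_append (p ++ [(0, 1)]) q (1, 0)
  simp only [List.append_assoc, List.cons_append, List.nil_append, List.length_append,
    List.length_cons, List.length_nil, zero_add, add_zero, add_assoc] at h1 h2 h3 h4 h5 h6
  unfold Cor
  simp only [List.append_assoc, List.cons_append, List.nil_append, List.length_append,
    List.length_cons]
  refine CorOn.glue (Nat.zero_le _) h1 ?_ (by omega) ⟨h3, h4⟩ ⟨h5, h6⟩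
  convert h2 using 1
  omega

theorem Cor.snoc_up {p : List (ℤ × ℤ)} (hp : Cor p) : Cor (p ++ [(0, 1)]) := by
  have h1 := (translateOn_append [] p [(0, 1)]).corOn_iff.mp hp
  simp only [List.nil_append, List.length_nil, zero_add] at h1
  have h3 := pathX_append p [] (0, 1)
  have h4 := pathY_append p [] (0, 1)
  unfold Cor
  rw [List.length_append]
  exact h1.snoc_up (Nat.zero_le _) ⟨by simpa using h3, by simpa using h4⟩

theorem unitSteps_up : UnitSteps [(0, 1)] := UnitSteps.nil.cons 2

theorem unitSteps_up_right : UnitSteps [(0, 1), (1, 0)] := (UnitSteps.nil.cons 0).cons 2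

theorem Zcor_mul_le {β : ℝ} (hβ : 0 ≤ β) (m n : ℕ) :
    Zcor β m * Zcor β n ≤ Zcor β (m + 2 + n) := by
  unfold Zcor
  rw [pathSum_mul_pathSum, pathSum_append, pathSum_append]
  refine pathSum_mono fun p hp _ => ?_
  refine le_trans (pathSum_mono fun q hq _ => ?_)
    (le_pathSum (f := fun r => pathSum (fun q => corWeight β (p ++ r ++ q)) n)
      (fun r => pathSum_nonneg (fun q => corWeight_nonneg β _) n) unitSteps_up_right)
  by_cases h1 : Cor p
  · by_cases h2 : Cor q
    · rw [corWeight_of_cor β h1, corWeight_of_cor β h2, corWeight_of_cor β (h1.glue h2),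
        ← Real.exp_add, ← mul_add]
      refine Real.exp_le_exp.mpr (mul_le_mul_of_nonneg_left ?_ hβ)
      exact_mod_cast Ham_append_le p _ q
    · have : corWeight β q = 0 := if_neg h2
      rw [this, mul_zero]
      exact corWeight_nonneg β _
  · have : corWeight β p = 0 := if_neg h1
    rw [this, zero_mul]
    exact corWeight_nonneg β _

theorem Zcor_le_succ {β : ℝ} (hβ : 0 ≤ β) (n : ℕ) : Zcor β n ≤ Zcor β (n + 1) := by
  unfold Zcor
  rw [pathSum_append]
  refine pathSum_mono fun p hp _ => ?_
  refine le_trans ?_ (le_pathSum (f := fun r => corWeight β (p ++ r))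
    (fun r => corWeight_nonneg β _) unitSteps_up)
  by_cases h1 : Cor p
  · rw [corWeight_of_cor β h1, corWeight_of_cor β h1.snoc_up]
    refine Real.exp_le_exp.mpr (mul_le_mul_of_nonneg_left ?_ hβ)
    have := Ham_append_le p [(0, 1)] []
    rw [Ham_nil, List.append_nil] at this
    exact_mod_cast this
  · have : corWeight β p = 0 := if_neg h1
    rw [this]
    exact corWeight_nonneg β _

theorem Zcor_mono {β : ℝ} (hβ : 0 ≤ β) : Monotone (Zcor β) :=
  monotone_nat_of_le_succ (Zcor_le_succ hβ)

theorem Zcor_zero (β : ℝ) : Zcor β 0 = 1 := by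
  simp [Zcor, pathSum, corWeight_of_cor β cor_nil, Ham_nil]

theorem one_le_Zcor {β : ℝ} (hβ : 0 ≤ β) (n : ℕ) : 1 ≤ Zcor β n := by
  rw [← Zcor_zero β]
  exact Zcor_mono hβ (Nat.zero_le n)

/-- The number of self-touchings of a prudent path is at most twice its length. -/
theorem Ham_le_of_prudentOn {l : List (ℤ × ℤ)}
    (h : PrudentOn 0 l.length (pathX l) (pathY l)) : Ham l ≤ 2 * l.length := by
  rw [Ham_eq_sum, Finset.range_eq_Ico]
  simpa using h.sum_touchCount_le (s := 0) le_rfl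

theorem pathSum_one (n : ℕ) : pathSum (fun _ => 1) n = 4 ^ n := by
  simp [pathSum_eq]

theorem Zcor_le {β : ℝ} (hβ : 0 ≤ β) (n : ℕ) :
    Zcor β n ≤ Real.exp ((2 * β + Real.log 4) * n) := by
  have h1 : Zcor β n ≤ Real.exp (2 * β * n) * pathSum (fun _ => 1) n := by
    rw [← pathSum_const_mul]
    refine pathSum_mono fun p _ hn => ?_
    rw [mul_one]
    by_cases h : Cor p
    · rw [corWeight_of_cor β h]
      refine Real.exp_le_exp.mpr ?_
      have h2 : (Ham p : ℝ) ≤ 2 * n := by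
        rw [← hn]; exact_mod_cast Ham_le_of_prudentOn h.prudent
      nlinarith
    · have : corWeight β p = 0 := if_neg h
      rw [this]
      exact (Real.exp_pos _).le
  refine h1.trans (le_of_eq ?_)
  rw [pathSum_one, add_mul, Real.exp_add, mul_comm (Real.log 4), Real.exp_nat_mul,
    Real.exp_log (by norm_num)]

/-- The free energy of corner pieces exists. -/
theorem exists_free_energy_cor {β : ℝ} (hβ : 0 ≤ β) : ∃ F : ℝ,
    Tendsto (fun n : ℕ => Real.log (Zcor β (n - 2)) / n) atTop (nhds F) ∧
    ∀ n : ℕ, Zcor β n ≤ Real.exp (F * (n + 2)) := by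
  have hpos : ∀ n, 0 < Zcor β n := fun n => zero_lt_one.trans_le (one_le_Zcor hβ n)
  have hsub : Subadditive fun n : ℕ => -Real.log (Zcor β (n - 2)) := by
    intro m n
    have key : ∀ m n : ℕ, m < 2 → -Real.log (Zcor β (m + n - 2)) ≤
        -Real.log (Zcor β (m - 2)) + -Real.log (Zcor β (n - 2)) := by
      intro m n hm
      rw [show m - 2 = 0 by omega, Zcor_zero, Real.log_one, neg_zero, zero_add, neg_le_neg_iff]
      exact Real.log_le_log (hpos _) (Zcor_mono hβ (by omega))
    by_cases hm : m < 2
    · exact key m n hm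
    by_cases hn : n < 2
    · have := key n m hn
      rwa [add_comm n m, add_comm (-Real.log (Zcor β (n - 2)))] at this
    · rw [← neg_add, neg_le_neg_iff, ← Real.log_mul (hpos _).ne' (hpos _).ne']
      refine Real.log_le_log (mul_pos (hpos _) (hpos _)) ((Zcor_mul_le hβ _ _).trans ?_)
      exact Zcor_mono hβ (by omega)
  have hbdd : BddBelow (Set.range fun n : ℕ => -Real.log (Zcor β (n - 2)) / n) := by
    have h4 : 0 ≤ Real.log 4 := Real.log_nonneg (by norm_num)
    refine ⟨-(2 * β + Real.log 4), ?_⟩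
    rintro _ ⟨n, rfl⟩
    rcases Nat.eq_zero_or_pos n with rfl | hn
    · simp; linarith
    · have hn' : (0 : ℝ) < n := by exact_mod_cast hn
      simp only
      rw [le_div_iff₀ hn', neg_mul, neg_le_neg_iff]
      have h1 := Real.log_le_log (hpos _) ((Zcor_mono hβ (Nat.sub_le n 2)).trans (Zcor_le hβ n))
      rwa [Real.log_exp] at h1
  refine ⟨-hsub.lim, ?_, fun n => ?_⟩
  · have := (hsub.tendsto_lim hbdd).neg
    refine this.congr fun n => ?_
    rw [neg_div, neg_neg]
  · have h1 := hsub.lim_le_div hbdd (n := n + 2) (by omega)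
    rw [Nat.add_sub_cancel, le_div_iff₀ (by positivity)] at h1
    rw [← Real.log_le_iff_le_exp (hpos n)]
    push_cast at h1
    linarith

/-! ## Corner pieces are NE-prudent paths -/

/-- The inter-stretch step of a block of given type. -/
def interStep (c : Bool) : ℤ × ℤ := bif c then (1, 0) else (0, 1)

/-- The run of steps of a stretch in a block of given type. -/
def stretchRun (c : Bool) (ℓ : ℤ) : List (ℤ × ℤ) := bif c then vrun ℓ else hrun ℓ

theorem stretchRun_zero (c : Bool) : stretchRun c 0 = [] := by
  cases c <;> simp [stretchRun, vrun, hrun]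

theorem stretchRun_neg_one (c : Bool) : stretchRun (!c) (-1) = [-interStep c] := by
  cases c <;> simp [stretchRun, vrun, hrun, interStep]

theorem stretchRun_add_one (c : Bool) {ℓ : ℤ} (h : 0 ≤ ℓ) :
    stretchRun c (ℓ + 1) = stretchRun c ℓ ++ [interStep (!c)] := by
  have h1 : (ℓ + 1).natAbs = ℓ.natAbs + 1 := by omega
  have h2 : 0 ≤ ℓ + 1 := by omega
  cases c <;> simp [stretchRun, vrun, hrun, interStep, h, h1, h2, List.replicate_succ']

theorem stretchRun_sub_one (c : Bool) {ℓ : ℤ} (h : ℓ ≤ 0) :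
    stretchRun c (ℓ - 1) = stretchRun c ℓ ++ [-interStep (!c)] := by
  have h1 : (ℓ - 1).natAbs = ℓ.natAbs + 1 := by omega
  have h2 : ¬ (1 ≤ ℓ) := by omega
  rcases h.eq_or_lt with rfl | h3
  · cases c <;> simp [stretchRun, vrun, hrun, interStep]
  · have h4 : ¬ (0 ≤ ℓ) := by omega
    cases c <;> simp [stretchRun, vrun, hrun, interStep, h1, h2, h4, List.replicate_succ']

theorem blockSteps_eq (c : Bool) (ℓs : List ℤ) :
    blockSteps c ℓs = List.intercalate [interStep c] (ℓs.map (stretchRun c)) := by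
  cases c <;> rfl

theorem exists_intercalate_append_singleton {α : Type*} (sep : List α) (ls : List (List α)) :
    ∃ z, ∀ w, List.intercalate sep (ls ++ [w]) = z ++ w := by
  induction ls with
  | nil => exact ⟨[], fun w => by simp⟩
  | cons l ls ih =>
    obtain ⟨z, hz⟩ := ih
    refine ⟨l ++ sep ++ z, fun w => ?_⟩
    rw [List.cons_append, List.intercalate_cons_of_ne_nil (by simp), hz]
    simp

theorem intercalate_append_singleton {α : Type*} (sep w : List α) {ls : List (List α)}
    (h : ls ≠ []) : List.intercalate sep (ls ++ [w]) = List.intercalate sep ls ++ sep ++ w := by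
  induction ls with
  | nil => exact absurd rfl h
  | cons l ls ih =>
    rcases ls.eq_nil_or_concat with rfl | ⟨ls', l', rfl⟩
    · simp [List.intercalate_cons_cons]
    · rw [List.cons_append, List.intercalate_cons_of_ne_nil (by simp), ih (by simp),
        List.intercalate_cons_of_ne_nil (by simp)]
      simp

theorem blockSteps_append_zero (c : Bool) {ℓs : List ℤ} (h : ℓs ≠ []) :
    blockSteps c (ℓs ++ [0]) = blockSteps c ℓs ++ [interStep c] := by
  rw [blockSteps_eq, blockSteps_eq, List.map_append, List.map_singleton,
    intercalate_append_singleton _ _ (by simpa using h), stretchRun_zero, List.append_nil]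

theorem blockSteps_add_one (c : Bool) (ℓs : List ℤ) {ℓ : ℤ} (h : 0 ≤ ℓ) :
    blockSteps c (ℓs ++ [ℓ + 1]) = blockSteps c (ℓs ++ [ℓ]) ++ [interStep (!c)] := by
  obtain ⟨z, hz⟩ := exists_intercalate_append_singleton [interStep c] (ℓs.map (stretchRun c))
  simp only [blockSteps_eq, List.map_append, List.map_singleton, hz, stretchRun_add_one c h,
    List.append_assoc]

theorem blockSteps_sub_one (c : Bool) (ℓs : List ℤ) {ℓ : ℤ} (h : ℓ ≤ 0) :
    blockSteps c (ℓs ++ [ℓ - 1]) = blockSteps c (ℓs ++ [ℓ]) ++ [-interStep (!c)] := by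
  obtain ⟨z, hz⟩ := exists_intercalate_append_singleton [interStep c] (ℓs.map (stretchRun c))
  simp only [blockSteps_eq, List.map_append, List.map_singleton, hz, stretchRun_sub_one c h,
    List.append_assoc]

theorem neSteps_append_singleton (b : Bool) (bs : List (List ℤ)) (ℓs : List ℤ) :
    neSteps b (bs ++ [ℓs]) = neSteps b bs ++ blockSteps (not^[bs.length] b) ℓs := by
  induction bs generalizing b with
  | nil => simp [neSteps]
  | cons l bs ih => simp [neSteps, ih]

/-- A walk in the coordinates `x, y` is at time `n` in a block started at `(X, Y)`, directed in
the first coordinate, with completed stretches `ℓs` and current stretch `a`. -/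
structure InBlock (x y : ℕ → ℤ) (n : ℕ) (X Y : ℤ) (ℓs : List ℤ) (a : ℤ) : Prop where
  posX : x n = X + ℓs.length
  posY : y n = Y + ℓs.sum + a
  starts : ∀ i ≤ ℓs.length, ∃ t ≤ n, x t = X + i ∧ y t = Y + (ℓs.take i).sum
  last : (a = 0 ∧ ∀ m, n = m + 1 → x m + 1 = x n ∧ y m = y n) ∨
    (0 < a ∧ ∃ m, n = m + 1 ∧ x m = x n ∧ y m + 1 = y n) ∨
    (a < 0 ∧ ∃ m, n = m + 1 ∧ x m = x n ∧ y m = y n + 1)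

namespace InBlock

variable {x y : ℕ → ℤ} {n T : ℕ} {X Y a : ℤ} {ℓs : List ℤ}

theorem forward (h : InBlock x y n X Y ℓs a) (hx : x (n + 1) = x n + 1)
    (hy : y (n + 1) = y n) : InBlock x y (n + 1) X Y (ℓs ++ [a]) 0 where
  posX := by rw [hx, h.posX]; simp [add_assoc]
  posY := by rw [hy, h.posY]; simp [add_assoc]
  starts i hi := by
    rw [List.length_append, List.length_singleton] at hi
    rcases hi.eq_or_lt with rfl | hlt
    · refine ⟨n + 1, le_rfl, ?_, ?_⟩
      · rw [hx, h.posX]; push_cast; ring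
      · rw [hy, h.posY, List.take_of_length_le (by simp)]; simp [add_assoc]
    · obtain ⟨t, h1, h2, h3⟩ := h.starts i (by omega)
      refine ⟨t, by omega, h2, ?_⟩
      rw [h3, List.take_append_of_le_length (by omega)]
  last := Or.inl ⟨rfl, fun m hm => by obtain rfl : n = m := by omega
                                      exact ⟨hx.symm, hy.symm⟩⟩

theorem nonneg_of_up (h : InBlock x y n X Y ℓs a) (hp : PrudentOn 0 T x y) (hn : n < T)
    (hy : y (n + 1) = y n + 1) : 0 ≤ a := by
  rcases h.last with h1 | h1 | ⟨_, m, rfl, h2, h3⟩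
  · omega
  · omega
  · have := hp.up (m + 1) m (Nat.zero_le _) (by omega) hn hy h2
    omega

theorem nonpos_of_down (h : InBlock x y n X Y ℓs a) (hp : PrudentOn 0 T x y) (hn : n < T)
    (hy : y (n + 1) = y n - 1) : a ≤ 0 := by
  rcases h.last with h1 | ⟨_, m, rfl, h2, h3⟩ | h1
  · omega
  · have := hp.down (m + 1) m (Nat.zero_le _) (by omega) hn hy h2
    omega
  · omega

theorem up (h : InBlock x y n X Y ℓs a) (ha : 0 ≤ a) (hx : x (n + 1) = x n)
    (hy : y (n + 1) = y n + 1) : InBlock x y (n + 1) X Y ℓs (a + 1) where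
  posX := hx.trans h.posX
  posY := by rw [hy, h.posY]; ring
  starts i hi := by
    obtain ⟨t, h1, h2⟩ := h.starts i hi
    exact ⟨t, by omega, h2⟩
  last := Or.inr (Or.inl ⟨by omega, n, rfl, hx.symm, hy.symm⟩)

theorem down (h : InBlock x y n X Y ℓs a) (ha : a ≤ 0) (hx : x (n + 1) = x n)
    (hy : y (n + 1) = y n - 1) : InBlock x y (n + 1) X Y ℓs (a - 1) where
  posX := hx.trans h.posX
  posY := by rw [hy, h.posY]; ring
  starts i hi := by
    obtain ⟨t, h1, h2⟩ := h.starts i hi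
    exact ⟨t, by omega, h2⟩
  last := Or.inr (Or.inr ⟨by omega, n, rfl, hx.symm, by omega⟩)

theorem backward (hx : x (n + 1) = x n - 1) (hy : y (n + 1) = y n) :
    InBlock y x (n + 1) (y n) (x n) [] (-1) where
  posX := by simp [hy]
  posY := by simp [hx, sub_eq_add_neg]
  starts i hi := by
    obtain rfl : i = 0 := by simpa using hi
    exact ⟨n, by omega, by simp, by simp⟩
  last := Or.inr (Or.inr ⟨by omega, n, rfl, hy.symm, by omega⟩)

/-- A block left by a backward step satisfies the upper exit condition. -/
theorem upperExit (h : InBlock x y n X Y ℓs a) (hp : PrudentOn 0 T x y) (hn : n < T)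
    (hpos : 0 < n) (hcor : ∀ j ≤ n, y j ≤ y n) (hx : x (n + 1) = x n - 1) :
    upperExit (ℓs ++ [a]) := by
  intro i hi
  rw [List.length_append, List.length_singleton] at hi
  obtain ⟨t, h1, h2, h3⟩ := h.starts i (by omega)
  rw [List.take_append_of_le_length (by omega), List.sum_append, List.sum_singleton]
  have h4 := hcor t h1
  have h5 := h.posY
  by_contra hcon
  have h6 := hp.left n t (Nat.zero_le _) h1 hn hx (by omega)
  have h7 := h.posX
  obtain rfl : i = ℓs.length := by omega
  rw [List.take_length] at hcon h3
  rcases h.last with ⟨_, h8⟩ | h8 | ⟨_, m, rfl, h8, h9⟩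
  · obtain ⟨m, rfl⟩ : ∃ m, n = m + 1 := ⟨n - 1, by omega⟩
    obtain ⟨h8, h9⟩ := h8 m rfl
    have := hp.left (m + 1) m (Nat.zero_le _) (by omega) hn hx h9
    omega
  · omega
  · have := hcor m (by omega)
    omega

end InBlock

/-- The steps `q` of a walk up to time `n` are decomposed into blocks, the current one being
of type `c`. -/
def BlockDecomp (x y : ℕ → ℤ) (c : Bool) (n : ℕ) (q : List (ℤ × ℤ)) : Prop :=
  ∃ (bs : List (List ℤ)) (ℓs : List ℤ) (a X Y : ℤ), not^[bs.length] true = c ∧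
    neSteps true (bs ++ [ℓs ++ [a]]) = q ∧ (∀ l ∈ bs, l ≠ [] ∧ upperExit l) ∧
    (∀ l ∈ bs.tail, l.headI < 0) ∧ (bs ≠ [] → (ℓs ++ [a]).headI < 0) ∧ InBlock x y n X Y ℓs a

namespace BlockDecomp

variable {x y : ℕ → ℤ} {c : Bool} {n T : ℕ} {q : List (ℤ × ℤ)}

theorem headI_append_ne_nil {l : List ℤ} (l' : List ℤ) (h : l ≠ []) :
    (l ++ l').headI = l.headI := by
  cases l with
  | nil => exact absurd rfl h
  | cons a l => rfl

theorem forward (h : BlockDecomp x y c n q) (hx : x (n + 1) = x n + 1) (hy : y (n + 1) = y n) :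
    BlockDecomp x y c (n + 1) (q ++ [interStep c]) := by
  obtain ⟨bs, ℓs, a, X, Y, h1, rfl, h3, h4, h5, h6⟩ := h
  refine ⟨bs, ℓs ++ [a], 0, X, Y, h1, ?_, h3, h4, fun hb => ?_, h6.forward hx hy⟩
  · simp only [neSteps_append_singleton]
    rw [blockSteps_append_zero _ (by simp), h1, List.append_assoc]
  · rw [headI_append_ne_nil _ (by simp)]
    exact h5 hb

theorem up (h : BlockDecomp x y c n q) (hp : PrudentOn 0 T x y) (hn : n < T)
    (hx : x (n + 1) = x n) (hy : y (n + 1) = y n + 1) :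
    BlockDecomp x y c (n + 1) (q ++ [interStep (!c)]) := by
  obtain ⟨bs, ℓs, a, X, Y, h1, rfl, h3, h4, h5, h6⟩ := h
  have ha := h6.nonneg_of_up hp hn hy
  refine ⟨bs, ℓs, a + 1, X, Y, h1, ?_, h3, h4, fun hb => ?_, h6.up ha hx hy⟩
  · simp only [neSteps_append_singleton]
    rw [blockSteps_add_one _ _ ha, h1, List.append_assoc]
  · have := h5 hb
    cases ℓs with
    | nil => simp at this; omega
    | cons b ℓs => exact this

theorem down (h : BlockDecomp x y c n q) (hp : PrudentOn 0 T x y) (hn : n < T)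
    (hx : x (n + 1) = x n) (hy : y (n + 1) = y n - 1) :
    BlockDecomp x y c (n + 1) (q ++ [-interStep (!c)]) := by
  obtain ⟨bs, ℓs, a, X, Y, h1, rfl, h3, h4, h5, h6⟩ := h
  have ha := h6.nonpos_of_down hp hn hy
  refine ⟨bs, ℓs, a - 1, X, Y, h1, ?_, h3, h4, fun hb => ?_, h6.down ha hx hy⟩
  · simp only [neSteps_append_singleton]
    rw [blockSteps_sub_one _ _ ha, h1, List.append_assoc]
  · have := h5 hb
    cases ℓs with
    | nil => simp at this ⊢; omega
    | cons b ℓs => exact this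

theorem backward (h : BlockDecomp x y c n q) (hp : PrudentOn 0 T x y) (hn : n < T)
    (hpos : 0 < n) (hcor : ∀ j ≤ n, y j ≤ y n) (hx : x (n + 1) = x n - 1)
    (hy : y (n + 1) = y n) :
    BlockDecomp y x (!c) (n + 1) (q ++ [-interStep c]) := by
  obtain ⟨bs, ℓs, a, X, Y, h1, rfl, h3, h4, h5, h6⟩ := h
  have hc : not^[(bs ++ [ℓs ++ [a]]).length] true = !c := by
    rw [List.length_append, List.length_singleton, Function.iterate_succ_apply', h1]
  refine ⟨bs ++ [ℓs ++ [a]], [], -1, y n, x n, hc, ?_, ?_, ?_, fun _ => by simp,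
    InBlock.backward hx hy⟩
  · rw [neSteps_append_singleton _ (bs ++ [ℓs ++ [a]]), hc]
    congr 1
    rw [blockSteps_eq]
    simp [stretchRun_neg_one]
  · intro l hl
    rw [List.mem_append, List.mem_singleton] at hl
    rcases hl with hl | rfl
    · exact h3 l hl
    · exact ⟨by simp, h6.upperExit hp hn hpos hcor hx⟩
  · intro l hl
    cases bs with
    | nil => simp at hl
    | cons b bs =>
      simp only [List.cons_append, List.tail_cons, List.mem_append, List.mem_singleton] at hl
      rcases hl with hl | rfl
      · exact h4 l hl
      · exact h5 (by simp)

theorem exists_isNEData (h : BlockDecomp x y c n q) :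
    ∃ (b : Bool) (bs : List (List ℤ)), IsNEData bs ∧ neSteps b bs = q := by
  obtain ⟨bs, ℓs, a, X, Y, h1, h2, h3, h4, h5, h6⟩ := h
  refine ⟨true, bs ++ [ℓs ++ [a]], ⟨by simp, fun l hl => ?_, fun i hi => ?_, fun i h0 hi => ?_⟩,
    h2⟩
  · rw [List.mem_append, List.mem_singleton] at hl
    rcases hl with hl | rfl
    · exact (h3 l hl).1
    · simp
  · rw [List.length_append, List.length_singleton] at hi
    rw [List.getD_append _ _ _ _ (by omega), List.getD_eq_getElem _ _ (by omega)]
    exact (h3 _ (List.getElem_mem _)).2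
  · rw [List.length_append, List.length_singleton] at hi
    by_cases hlt : i < bs.length
    · rw [List.getD_append _ _ _ _ hlt, List.getD_eq_getElem _ _ hlt]
      refine h4 _ ?_
      obtain ⟨k, rfl⟩ : ∃ k, i = k + 1 := ⟨i - 1, by omega⟩
      have : bs[k + 1] = bs.tail[k]'(by simp; omega) := by simp
      rw [this]
      exact List.getElem_mem _
    · obtain rfl : i = bs.length := by omega
      rw [List.getD_append_right _ _ _ _ le_rfl, Nat.sub_self, List.getD_cons_zero]
      exact h5 (List.ne_nil_of_length_pos h0)

end BlockDecomp

theorem Cor.exists_blockDecomp {p : List (ℤ × ℤ)} (hu : UnitSteps p) (h : Cor p) (n : ℕ)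
    (hn : n ≤ p.length) : BlockDecomp (pathX p) (pathY p) true n (p.take n) ∨
      (0 < n ∧ BlockDecomp (pathY p) (pathX p) false n (p.take n)) := by
  induction n with
  | zero =>
    refine Or.inl ⟨[], [], 0, 0, 0, rfl, ?_, by simp, by simp, by simp, ?_, ?_, ?_, ?_⟩
    · simp [neSteps, blockSteps_eq, stretchRun_zero]
    · simp [pathX, pt]
    · simp [pathY, pt]
    · intro i hi
      obtain rfl : i = 0 := by simpa using hi
      exact ⟨0, le_rfl, by simp [pathX, pt], by simp [pathY, pt]⟩
    · exact Or.inl ⟨rfl, fun m hm => by omega⟩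
  | succ n ih =>
    have hlt : n < p.length := hn
    have hx := pathX_succ p hlt
    have hy := pathY_succ p hlt
    have hp := h.prudent
    rw [← List.take_concat_get' p n hlt]
    have hc1 : pathX p (n + 1) = pathX p n - 1 → ∀ j ≤ n, pathY p j ≤ pathY p n :=
      fun h1 j hj => h.corner.1 n j (Nat.zero_le _) hj hlt h1
    have hc2 : pathY p (n + 1) = pathY p n - 1 → ∀ j ≤ n, pathX p j ≤ pathX p n :=
      fun h1 j hj => h.corner.2.1 n j (Nat.zero_le _) hj hlt h1
    have hpos : pathX p (n + 1) = pathX p n - 1 → 0 < n := fun h1 => by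
      rcases n.eq_zero_or_pos with rfl | h2
      · exact absurd h1 (h.first hlt)
      · exact h2
    rcases hu.cases (List.getElem_mem hlt) with hd | hd | hd | hd <;> rw [hd] at hx hy ⊢ <;>
      simp only [add_zero, ← sub_eq_add_neg] at hx hy <;>
      rcases ih hlt.le with h1 | ⟨h0, h1⟩
    · exact Or.inl (h1.forward hx hy)
    · exact Or.inr ⟨by omega, h1.up hp.swap hlt hy hx⟩
    · exact Or.inr ⟨by omega, h1.backward hp hlt (hpos hx) (hc1 hx) hx hy⟩
    · exact Or.inr ⟨by omega, h1.down hp.swap hlt hy hx⟩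
    · exact Or.inl (h1.up hp hlt hx hy)
    · exact Or.inr ⟨by omega, h1.forward hy hx⟩
    · exact Or.inl (h1.down hp hlt hx hy)
    · exact Or.inl (h1.backward hp.swap hlt h0 (hc2 hy) hy hx)

theorem Cor.isNEPath {p : List (ℤ × ℤ)} (hu : UnitSteps p) (h : Cor p) : IsNEPath p := by
  refine ⟨(isPrudent_iff hu).mpr h.prudent, ?_⟩
  have := h.exists_blockDecomp hu p.length le_rfl
  rw [List.take_length] at this
  rcases this with h1 | ⟨_, h1⟩
  · exact h1.exists_isNEData
  · exact h1.exists_isNEData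

theorem unitSteps_stepsOf {n : ℕ} (s : Fin n → Fin 4) : UnitSteps (stepsOf s) := by
  intro d hd
  obtain ⟨k, _, rfl⟩ := List.mem_map.mp hd
  exact ⟨k, rfl⟩

theorem Zcor_le_Zne (β : ℝ) (n : ℕ) : Zcor β n ≤ Zne β n := by
  unfold Zcor Zne neFinset
  rw [pathSum_eq, Finset.sum_filter]
  refine Finset.sum_le_sum fun s _ => ?_
  unfold corWeight
  split_ifs with h1 h2 h2
  · exact le_rfl
  · exact absurd (h1.isNEPath (unitSteps_stepsOf s)) h2
  · exact (Real.exp_pos _).le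
  · exact le_rfl

theorem Zne_le_Zpsaw (β : ℝ) (n : ℕ) : Zne β n ≤ Zpsaw β n := by
  refine Finset.sum_le_sum_of_subset_of_nonneg (fun s hs => ?_) fun _ _ _ => (Real.exp_pos _).le
  simp only [neFinset, psawFinset, Finset.mem_filter] at hs ⊢
  exact ⟨hs.1, hs.2.1⟩

/-! ## The zigzag path and a lower bound on the free energy -/

/-- The first coordinate of the path made of vertical columns of height `h`. -/
def zigX (h i : ℕ) : ℤ := (i / (h + 1) : ℕ)

/-- The second coordinate of the path made of vertical columns of height `h`. -/
def zigY (h i : ℕ) : ℤ :=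
  if i / (h + 1) % 2 = 0 then (i % (h + 1) : ℕ) else h - (i % (h + 1) : ℕ)

theorem zig_at {h q r : ℕ} (hr : r ≤ h) : zigX h (q * (h + 1) + r) = q ∧
    zigY h (q * (h + 1) + r) = if q % 2 = 0 then (r : ℤ) else h - r := by
  have h1 : (q * (h + 1) + r) / (h + 1) = q := by
    rw [mul_comm, Nat.mul_add_div (by omega), Nat.div_eq_of_lt (by omega), add_zero]
  have h2 : (q * (h + 1) + r) % (h + 1) = r := by
    rw [mul_comm, Nat.mul_add_mod, Nat.mod_eq_of_lt (by omega)]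
  simp [zigX, zigY, h1, h2]

theorem exists_zig_index (h i : ℕ) : ∃ q r, r ≤ h ∧ i = q * (h + 1) + r :=
  ⟨i / (h + 1), i % (h + 1), Nat.lt_succ_iff.mp (Nat.mod_lt _ (Nat.succ_pos h)),
    (Nat.div_add_mod' i (h + 1)).symm⟩

theorem zigX_mono (h : ℕ) : Monotone (zigX h) := fun i j hij => by
  unfold zigX
  exact_mod_cast Nat.div_le_div_right hij

theorem zigY_le (h i : ℕ) : zigY h i ≤ h := by
  obtain ⟨q, r, hr, rfl⟩ := exists_zig_index h i
  rw [(zig_at hr).2]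
  split_ifs <;> omega

theorem zig_succ (h q r : ℕ) (hr : r ≤ h) :
    (zigX h (q * (h + 1) + r + 1) = q + 1 ∧
      zigY h (q * (h + 1) + r + 1) = zigY h (q * (h + 1) + r)) ∨
    (zigX h (q * (h + 1) + r + 1) = q ∧ q % 2 = 0 ∧ zigY h (q * (h + 1) + r + 1) = r + 1) ∨
    (zigX h (q * (h + 1) + r + 1) = q ∧ q % 2 = 1 ∧
      zigY h (q * (h + 1) + r + 1) = h - (r + 1)) := by
  rcases hr.eq_or_lt with rfl | hlt
  · left
    have h1 := zig_at (h := r) (q := q + 1) (Nat.zero_le r)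
    have h2 := zig_at (h := r) (q := q) le_rfl
    rw [show (q + 1) * (r + 1) + 0 = q * (r + 1) + r + 1 by ring] at h1
    refine ⟨by rw [h1.1]; push_cast; ring, ?_⟩
    rw [h1.2, h2.2]
    rcases Nat.mod_two_eq_zero_or_one q with h3 | h3
    · rw [if_neg (by omega), if_pos h3]; simp
    · rw [if_pos (by omega), if_neg (by omega)]; simp
  · right
    have h1 := zig_at (h := h) (q := q) (r := r + 1) hlt
    rw [← add_assoc] at h1
    rcases Nat.mod_two_eq_zero_or_one q with h3 | h3
    · rw [if_pos h3] at h1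
      exact Or.inl ⟨h1.1, h3, by rw [h1.2]; push_cast; ring⟩
    · rw [if_neg (by omega)] at h1
      exact Or.inr ⟨h1.1, h3, by rw [h1.2]; push_cast; ring⟩

theorem zig_corOn (h m : ℕ) :
    CorOn (zigX h) (zigY h) 0 (2 * m * (h + 1) + h) := by
  have hstep : ∀ i, ((zigX h (i + 1) = zigX h i + 1 ∧ zigY h (i + 1) = zigY h i) ∨
      (zigX h (i + 1) = zigX h i ∧ zigY h (i + 1) = zigY h i + 1 ∧
        ∀ j ≤ i, zigX h j = zigX h i → zigY h j ≤ zigY h i) ∨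
      (zigX h (i + 1) = zigX h i ∧ zigY h (i + 1) = zigY h i - 1 ∧
        ∀ j ≤ i, zigX h j = zigX h i → zigY h i ≤ zigY h j)) := by
    intro i
    obtain ⟨q, r, hr, rfl⟩ := exists_zig_index h i
    have e1 := zig_at (q := q) hr
    rcases zig_succ h q r hr with h1 | ⟨h1, h2, h3⟩ | ⟨h1, h2, h3⟩
    · exact Or.inl ⟨by omega, h1.2⟩
    · rw [if_pos h2] at e1
      refine Or.inr (Or.inl ⟨by omega, by omega, fun j hj hx => ?_⟩)
      obtain ⟨q', r', hr', rfl⟩ := exists_zig_index h j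
      have e2 := zig_at (q := q') hr'
      obtain rfl : q' = q := by omega
      rw [if_pos h2] at e2
      omega
    · rw [if_neg (by omega)] at e1
      refine Or.inr (Or.inr ⟨by omega, by omega, fun j hj hx => ?_⟩)
      obtain ⟨q', r', hr', rfl⟩ := exists_zig_index h j
      have e2 := zig_at (q := q') hr'
      obtain rfl : q' = q := by omega
      rw [if_neg (by omega)] at e2
      omega
  have hend : zigY h (2 * m * (h + 1) + h) = h := by
    rw [(zig_at le_rfl).2, if_pos (by omega)]
  refine ⟨⟨fun i _ _ => ?_, fun i j _ hj _ _ _ => zigX_mono h hj, fun i j _ hj _ h4 h5 => ?_,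
    fun i j _ hj _ h4 h5 => ?_, fun i j _ hj _ h4 h5 => ?_⟩, ⟨fun i j _ hj _ h4 => ?_,
    fun i j _ hj _ h4 => zigX_mono h hj, fun j _ hj => ⟨zigX_mono h hj, ?_⟩⟩, fun _ h4 => ?_⟩
  · have := hstep i; omega
  · have := hstep i; omega
  · rcases hstep i with h6 | h6 | h6
    · omega
    · exact h6.2.2 j hj h5
    · omega
  · rcases hstep i with h6 | h6 | h6
    · omega
    · omega
    · exact h6.2.2 j hj h5
  · have := hstep i; omega
  · rw [hend]; exact zigY_le h j
  · have := hstep 0; omega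

theorem two_le_touchCount_zig {h q r : ℕ} (hr : r + 2 ≤ h) :
    2 ≤ touchCount (zigX h) (zigY h) 0 ((q + 1) * (h + 1) + (r + 1)) := by
  have e1 := zig_at (q := q + 1) (r := r) (h := h) (by omega)
  have e2 := zig_at (q := q + 1) (r := r + 1) (h := h) (by omega)
  have e3 := zig_at (q := q + 1) (r := r + 2) (h := h) (by omega)
  have e4 := zig_at (q := q) (r := h - (r + 2)) (h := h) (by omega)
  have e5 := zig_at (q := q) (r := h - (r + 2) + 1) (h := h) (by omega)
  have hne : (q + 1) * (h + 1) + r ≠ q * (h + 1) + (h - (r + 2)) := by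
    have : (q + 1) * (h + 1) = q * (h + 1) + (h + 1) := by ring
    omega
  have hlt : q * (h + 1) + (h - (r + 2)) < (q + 1) * (h + 1) + (r + 1) := by
    have : (q + 1) * (h + 1) = q * (h + 1) + (h + 1) := by ring
    omega
  have hc : ((h - (r + 2) : ℕ) : ℤ) = h - (r + 2) := by omega
  have htwo : ({(q + 1) * (h + 1) + r, q * (h + 1) + (h - (r + 2))} : Finset ℕ).card = 2 :=
    Finset.card_pair hne
  rw [← htwo]
  refine Finset.card_le_card fun j hj => ?_
  simp only [Finset.mem_insert, Finset.mem_singleton] at hj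
  simp only [Finset.mem_filter, Finset.mem_Ico]
  rcases hj with rfl | rfl
  · refine ⟨⟨Nat.zero_le _, by omega⟩, ?_⟩
    unfold Touch
    rw [show (q + 1) * (h + 1) + r + 1 = (q + 1) * (h + 1) + (r + 1) by ring,
      show (q + 1) * (h + 1) + (r + 1) + 1 = (q + 1) * (h + 1) + (r + 2) by ring,
      e1.1, e1.2, e2.1, e2.2, e3.1, e3.2]
    push_cast
    split_ifs <;> ring
  · refine ⟨⟨Nat.zero_le _, hlt⟩, ?_⟩
    unfold Touch
    rw [show q * (h + 1) + (h - (r + 2)) + 1 = q * (h + 1) + (h - (r + 2) + 1) by ring,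
      show (q + 1) * (h + 1) + (r + 1) + 1 = (q + 1) * (h + 1) + (r + 2) by ring,
      e2.1, e2.2, e3.1, e3.2, e4.1, e4.2, e5.1, e5.2]
    push_cast
    rw [hc]
    rcases Nat.mod_two_eq_zero_or_one q with h3 | h3
    · have h4 : (q + 1) % 2 ≠ 0 := by omega
      simp only [h3, h4, if_true, if_false]
      ring
    · have h4 : (q + 1) % 2 = 0 := by omega
      simp only [h3, h4, if_true, one_ne_zero, if_false]
      ring

theorem le_sum_touchCount_zig (h m : ℕ) : 2 * (2 * m * (h - 1)) ≤
    ∑ i ∈ Finset.range (2 * m * (h + 1) + h), touchCount (zigX h) (zigY h) 0 i := by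
  set f : ℕ × ℕ → ℕ := fun a => (a.1 + 1) * (h + 1) + (a.2 + 1) with hf
  set A := Finset.range (2 * m) ×ˢ Finset.range (h - 1) with hA
  have hinj : Set.InjOn f A := by
    rintro ⟨q, r⟩ hq ⟨q', r'⟩ hq' heq
    simp only [hA, Finset.coe_product, Set.mem_prod, Finset.mem_coe, Finset.mem_range] at hq hq'
    have h1 := zig_at (h := h) (q := q + 1) (r := r + 1) (by omega)
    have h2 := zig_at (h := h) (q := q' + 1) (r := r' + 1) (by omega)
    simp only [hf] at heq
    rw [heq] at h1
    obtain rfl : q = q' := by have := h1.1.symm.trans h2.1; push_cast at this; omega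
    simp at heq
    rw [heq]
  calc 2 * (2 * m * (h - 1)) = ∑ i ∈ A.image f, 2 := by
        rw [Finset.sum_const, Finset.card_image_of_injOn hinj, hA, Finset.card_product,
          Finset.card_range, Finset.card_range, smul_eq_mul]
        ring
    _ ≤ ∑ i ∈ A.image f, touchCount (zigX h) (zigY h) 0 i := by
        refine Finset.sum_le_sum fun i hi => ?_
        obtain ⟨⟨q, r⟩, hq, rfl⟩ := Finset.mem_image.mp hi
        simp only [hA, Finset.mem_product, Finset.mem_range] at hq
        exact two_le_touchCount_zig (by omega)
    _ ≤ _ := by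
        refine Finset.sum_le_sum_of_subset fun i hi => ?_
        obtain ⟨⟨q, r⟩, hq, rfl⟩ := Finset.mem_image.mp hi
        simp only [hA, Finset.mem_product, Finset.mem_range] at hq
        have : (q + 1) * (h + 1) ≤ 2 * m * (h + 1) := Nat.mul_le_mul_right _ (by omega)
        simp only [hf, Finset.mem_range]
        omega

/-- A nearest-neighbour walk started at the origin is the walk of a list of unit steps. -/
theorem exists_translateOn {x y : ℕ → ℤ} {n : ℕ} (h : PrudentOn 0 n x y) (hx : x 0 = 0)
    (hy : y 0 = 0) : ∃ l : List (ℤ × ℤ), UnitSteps l ∧ l.length = n ∧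
      TranslateOn x y (pathX l) (pathY l) 0 n := by
  set l := (List.range n).map fun i => (x (i + 1) - x i, y (i + 1) - y i) with hl
  have hlen : l.length = n := by simp [hl]
  refine ⟨l, fun d hd => ?_, hlen, 0, 0, fun i hi => ?_⟩
  · simp only [hl, List.mem_map, List.mem_range] at hd
    obtain ⟨i, hi, rfl⟩ := hd
    rcases h.step i (Nat.zero_le _) hi with ⟨h1, h2⟩ | ⟨h1, h2⟩ | ⟨h1, h2⟩ | ⟨h1, h2⟩ <;>
      rw [h1, h2]
    · exact ⟨0, by simp [dirs]⟩
    · exact ⟨1, by simp [dirs]⟩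
    · exact ⟨2, by simp [dirs]⟩
    · exact ⟨3, by simp [dirs]⟩
  · simp only [zero_add, sub_zero]
    induction i with
    | zero => simp [pathX, pathY, pt, hx, hy]
    | succ i ih =>
      obtain ⟨h1, h2⟩ := ih (by omega)
      rw [pathX_succ l (by omega), pathY_succ l (by omega), h1, h2]
      simp [hl]

theorem exists_cor_zig (h m : ℕ) : ∃ l : List (ℤ × ℤ), UnitSteps l ∧
    l.length = 2 * m * (h + 1) + h ∧ Cor l ∧ 2 * (2 * m * (h - 1)) ≤ Ham l := by
  have hc := zig_corOn h m
  obtain ⟨l, h1, h2, h3⟩ := exists_translateOn hc.prudent (by simp [zigX]) (by simp [zigY])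
  refine ⟨l, h1, h2, ?_, ?_⟩
  · unfold Cor
    rw [h2, h3.corOn_iff, zero_add]
    exact hc
  · rw [Ham_eq_sum, h2, h3.sum_touchCount_eq, zero_add, ← Finset.range_eq_Ico]
    exact le_sum_touchCount_zig h m

/-- The collapsed zigzag path bounds the free energy from below. -/
theorem two_mul_le_of_Zcor_le {β F : ℝ} (hβ : 0 ≤ β)
    (hF : ∀ n : ℕ, Zcor β n ≤ Real.exp (F * (n + 2))) : 2 * β ≤ F := by
  have key : ∀ m : ℕ, 0 < m → (2 * β - F) * m ≤ 5 * F + 4 * β := by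
    intro m hm
    obtain ⟨l, h1, h2, h3, h4⟩ := exists_cor_zig m m
    have h5 := le_pathSum (corWeight_nonneg β) h1
    rw [corWeight_of_cor β h3] at h5
    have h6 := Real.exp_le_exp.mp (h5.trans (hF l.length))
    rw [h2] at h6
    have h7 : ((2 * (2 * m * (m - 1 : ℕ)) : ℕ) : ℝ) ≤ Ham l := by exact_mod_cast h4
    push_cast [Nat.cast_sub (show 1 ≤ m from hm)] at h6 h7
    have h8 := (mul_le_mul_of_nonneg_left h7 hβ).trans h6
    have hm' : (1 : ℝ) ≤ m := by exact_mod_cast hm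
    have hF0 : 0 ≤ F := by
      have := (one_le_Zcor hβ 0).trans (hF 0)
      rw [← Real.exp_zero, Real.exp_le_exp] at this
      push_cast at this
      linarith
    have h9 : (2 * m) * ((2 * β - F) * m) ≤ (2 * m) * (5 * F + 4 * β) := by
      nlinarith
    exact le_of_mul_le_mul_left h9 (by positivity)
  by_contra hcon
  push Not at hcon
  obtain ⟨m, hm⟩ := exists_nat_gt (max ((5 * F + 4 * β) / (2 * β - F)) 1)
  have h1 := key m (by
    have : (1 : ℝ) < m := (le_max_right _ _).trans_lt hm
    exact_mod_cast zero_lt_one.trans this)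
  have h2 := (le_max_left _ _).trans_lt hm
  rw [div_lt_iff₀ (by linarith)] at h2
  linarith

/-! ## Symmetries of the square lattice -/

/-- The symmetries of `ℤ²` fixing the origin: sign changes, followed by an exchange of the
coordinates. -/
def latticeSymm (g : Bool × Bool × Bool) (d : ℤ × ℤ) : ℤ × ℤ :=
  let e : ℤ × ℤ := (bif g.1 then -d.1 else d.1, bif g.2.1 then -d.2 else d.2)
  bif g.2.2 then e.swap else e

theorem latticeSymm_zero (g : Bool × Bool × Bool) : latticeSymm g 0 = 0 := by
  obtain ⟨a, b, c⟩ := g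
  cases a <;> cases b <;> cases c <;> simp [latticeSymm]

theorem latticeSymm_add (g : Bool × Bool × Bool) (d e : ℤ × ℤ) :
    latticeSymm g (d + e) = latticeSymm g d + latticeSymm g e := by
  obtain ⟨a, b, c⟩ := g
  cases a <;> cases b <;> cases c <;> ext <;> simp [latticeSymm, add_comm]

theorem latticeSymm_sub (g : Bool × Bool × Bool) (d e : ℤ × ℤ) :
    latticeSymm g (d - e) = latticeSymm g d - latticeSymm g e := by
  rw [eq_sub_iff_add_eq, ← latticeSymm_add, sub_add_cancel]

theorem sq_latticeSymm (g : Bool × Bool × Bool) (d : ℤ × ℤ) :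
    (latticeSymm g d).1 ^ 2 + (latticeSymm g d).2 ^ 2 = d.1 ^ 2 + d.2 ^ 2 := by
  obtain ⟨a, b, c⟩ := g
  cases a <;> cases b <;> cases c <;> simp [latticeSymm, add_comm]

theorem exists_perm_latticeSymm (g : Bool × Bool × Bool) :
    ∃ e : Equiv.Perm (Fin 4), ∀ k, latticeSymm g (dirs k) = dirs (e k) := by
  revert g
  decide

theorem pt_map_latticeSymm (g : Bool × Bool × Bool) (l : List (ℤ × ℤ)) (i : ℕ) :
    pt (l.map (latticeSymm g)) i = latticeSymm g (pt l i) := by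
  unfold pt
  rw [← List.map_take]
  induction l.take i with
  | nil => simp [latticeSymm_zero]
  | cons d l ih => simp [latticeSymm_add, ih]

theorem Ham_map_latticeSymm (g : Bool × Bool × Bool) (l : List (ℤ × ℤ)) :
    Ham (l.map (latticeSymm g)) = Ham l := by
  unfold Ham
  rw [List.length_map]
  congr 1
  refine Finset.filter_congr fun a _ => ?_
  simp only [dmid, pt_map_latticeSymm, ← latticeSymm_add, ← latticeSymm_sub, sq_latticeSymm]

theorem exists_corOn {x y : ℕ → ℤ} {n : ℕ} (hp : PrudentOn 0 n x y) (h : CornerOn x y 0 n) :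
    CorOn x y 0 n ∨ CorOn y x 0 n := by
  by_cases h1 : 0 < n → x (0 + 1) ≠ x 0 - 1
  · exact Or.inl ⟨hp, h, h1⟩
  · push Not at h1
    refine Or.inr ⟨hp.swap, h.swap, fun h2 => ?_⟩
    have := hp.step 0 le_rfl h2
    omega

/-- A prudent corner piece up to reflections is a symmetric image of a corner piece. -/
theorem exists_cor_map {p : List (ℤ × ℤ)} (hp : PrudentOn 0 p.length (pathX p) (pathY p))
    (h : ReflCornerOn (pathX p) (pathY p) 0 p.length) :
    ∃ g, Cor (p.map (latticeSymm g)) := by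
  have key : ∀ g, CorOn (fun i => (latticeSymm g (pt p i)).1) (fun i => (latticeSymm g (pt p i)).2)
      0 p.length → ∃ g, Cor (p.map (latticeSymm g)) := by
    intro g hg
    refine ⟨g, ?_⟩
    unfold Cor
    rw [List.length_map]
    convert hg using 2 with i i
    · simp [pathX, pt_map_latticeSymm]
    · simp [pathY, pt_map_latticeSymm]
  rcases h with h | h | h | h
  · rcases exists_corOn hp h with h1 | h1
    · exact key (false, false, false) h1
    · exact key (false, false, true) h1
  · rcases exists_corOn hp.negX h with h1 | h1
    · exact key (true, false, false) h1
    · exact key (true, false, true) h1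
  · rcases exists_corOn hp.negY h with h1 | h1
    · exact key (false, true, false) h1
    · exact key (false, true, true) h1
  · rcases exists_corOn hp.negX.negY h with h1 | h1
    · exact key (true, true, false) h1
    · exact key (true, true, true) h1

/-! ## The weight of a piece -/

open scoped Classical in
/-- The weight of a piece: a corner piece up to symmetry, or a straight segment. -/
noncomputable def pieceWeight (β : ℝ) (p : List (ℤ × ℤ)) : ℝ :=
  ∑ g, corWeight β (p.map (latticeSymm g)) +
    Real.exp (2 * β * p.length) * ∑ k : Fin 4, if ∀ d ∈ p, d = dirs k then 1 else 0

theorem pieceWeight_nonneg (β : ℝ) (p : List (ℤ × ℤ)) : 0 ≤ pieceWeight β p := by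
  classical
  refine add_nonneg (Finset.sum_nonneg fun g _ => corWeight_nonneg _ _)
    (mul_nonneg (Real.exp_pos _).le (Finset.sum_nonneg fun k _ => ?_))
  split_ifs <;> norm_num

theorem exp_Ham_le_pieceWeight (β : ℝ) {p : List (ℤ × ℤ)} {g : Bool × Bool × Bool}
    (h : Cor (p.map (latticeSymm g))) : Real.exp (β * Ham p) ≤ pieceWeight β p := by
  classical
  rw [← Ham_map_latticeSymm g p, ← corWeight_of_cor β h]
  refine (Finset.single_le_sum (f := fun g => corWeight β (p.map (latticeSymm g)))
    (fun g _ => corWeight_nonneg _ _) (Finset.mem_univ g)).trans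
    (le_add_of_nonneg_right (mul_nonneg (Real.exp_pos _).le (Finset.sum_nonneg fun k _ => ?_)))
  split_ifs <;> norm_num

theorem exp_length_le_pieceWeight (β : ℝ) {p : List (ℤ × ℤ)} {k : Fin 4}
    (h : ∀ d ∈ p, d = dirs k) : Real.exp (2 * β * p.length) ≤ pieceWeight β p := by
  classical
  refine le_add_of_nonneg_of_le (Finset.sum_nonneg fun g _ => corWeight_nonneg _ _)
    (le_mul_of_one_le_right (Real.exp_pos _).le ?_)
  refine le_trans (le_of_eq ?_) (Finset.single_le_sum
    (f := fun k : Fin 4 => if ∀ d ∈ p, d = dirs k then (1 : ℝ) else 0)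
    (fun k _ => ?_) (Finset.mem_univ k))
  · rw [if_pos h]
  · split_ifs <;> norm_num

open scoped Classical in
theorem pathSum_straight (k : Fin 4) (n : ℕ) :
    pathSum (fun p => if ∀ d ∈ p, d = dirs k then 1 else 0) n = 1 := by
  have hinj : Function.Injective dirs := by decide
  induction n with
  | zero => simp [pathSum]
  | succ n ih =>
    rw [pathSum, Finset.sum_eq_single k]
    · simpa using ih
    · intro j _ hj
      rw [pathSum_eq]
      refine Finset.sum_eq_zero fun s _ => if_neg fun h => hj (hinj (h _ (by simp)))
    · simp

theorem pathSum_pieceWeight_le {β F : ℝ} (hF : ∀ n : ℕ, Zcor β n ≤ Real.exp (F * (n + 2)))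
    (hβF : 2 * β ≤ F) (n : ℕ) :
    pathSum (pieceWeight β) n ≤ (8 * Real.exp (2 * F) + 4) * Real.exp (F * n) := by
  classical
  have h1 : pathSum (fun p => ∑ g, corWeight β (p.map (latticeSymm g))) n = 8 * Zcor β n := by
    rw [pathSum_finset_sum]
    have : ∀ g ∈ (Finset.univ : Finset (Bool × Bool × Bool)),
        pathSum (fun p => corWeight β (p.map (latticeSymm g))) n = Zcor β n := by
      intro g _
      obtain ⟨e, he⟩ := exists_perm_latticeSymm g
      exact pathSum_map e he _ n
    rw [Finset.sum_congr rfl this]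
    simp
  have h2 : pathSum (fun p => Real.exp (2 * β * p.length) *
      ∑ k : Fin 4, if ∀ d ∈ p, d = dirs k then 1 else 0) n = Real.exp (2 * β * n) * 4 := by
    rw [pathSum_congr (g := fun p => Real.exp (2 * β * n) *
      ∑ k : Fin 4, if ∀ d ∈ p, d = dirs k then 1 else 0) fun p _ hn => by rw [hn],
      pathSum_const_mul, pathSum_finset_sum]
    rw [Finset.sum_congr rfl fun k _ => pathSum_straight k n]
    simp
  have h3 : pathSum (pieceWeight β) n = 8 * Zcor β n + Real.exp (2 * β * n) * 4 := by
    rw [← h1, ← h2, ← pathSum_add]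
    exact pathSum_congr fun p _ _ => by unfold pieceWeight; congr!
  have h4 : Real.exp (2 * β * n) ≤ Real.exp (F * n) :=
    Real.exp_le_exp.mpr (mul_le_mul_of_nonneg_right hβF (Nat.cast_nonneg n))
  have h5 := hF n
  rw [mul_add, Real.exp_add, mul_comm F 2] at h5
  rw [h3]
  linarith

/-! ## Sums over decompositions into pieces -/

/-- The total weight of the decompositions of a path into `k` nonempty pieces. -/
noncomputable def decompWeight (β : ℝ) : ℕ → List (ℤ × ℤ) → ℝ
  | 0, l => if l.length = 0 then 1 else 0
  | k + 1, l => ∑ m ∈ Finset.range l.length,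
      pieceWeight β (l.take (m + 1)) * decompWeight β k (l.drop (m + 1))

theorem decompWeight_nonneg (β : ℝ) (k : ℕ) (l : List (ℤ × ℤ)) : 0 ≤ decompWeight β k l := by
  induction k generalizing l with
  | zero => unfold decompWeight; split_ifs <;> norm_num
  | succ k ih => exact Finset.sum_nonneg fun m _ => mul_nonneg (pieceWeight_nonneg _ _) (ih _)

theorem le_decompWeight_succ (β : ℝ) (k : ℕ) {l : List (ℤ × ℤ)} {m : ℕ} (hm : 0 < m)
    (hml : m ≤ l.length) :
    pieceWeight β (l.take m) * decompWeight β k (l.drop m) ≤ decompWeight β (k + 1) l := by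
  obtain ⟨m, rfl⟩ : ∃ j, m = j + 1 := ⟨m - 1, by omega⟩
  exact Finset.single_le_sum
    (f := fun m => pieceWeight β (l.take (m + 1)) * decompWeight β k (l.drop (m + 1)))
    (fun m _ => mul_nonneg (pieceWeight_nonneg _ _) (decompWeight_nonneg _ _ _))
    (Finset.mem_range.mpr hml)

theorem pathSum_decompWeight_le {β F D : ℝ} (hD0 : 0 ≤ D)
    (hD : ∀ n : ℕ, pathSum (pieceWeight β) n ≤ D * Real.exp (F * n)) (k n : ℕ) :
    pathSum (decompWeight β k) n ≤ Real.exp (F * n) * (D ^ k * n.choose k) := by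
  induction k generalizing n with
  | zero =>
    rw [pathSum_congr (g := fun _ => if n = 0 then 1 else 0) fun l _ hl => by
      simp [decompWeight, ← hl]]
    rcases n.eq_zero_or_pos with rfl | hn
    · simp [pathSum]
    · simp only [hn.ne', if_false, pathSum_eq, Finset.sum_const_zero]
      positivity
  | succ k ih =>
    have h1 : pathSum (decompWeight β (k + 1)) n = ∑ m ∈ Finset.range n,
        pathSum (pieceWeight β) (m + 1) * pathSum (decompWeight β k) (n - (m + 1)) := by
      rw [pathSum_congr (g := fun l => ∑ m ∈ Finset.range n,
        pieceWeight β (l.take (m + 1)) * decompWeight β k (l.drop (m + 1)))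
        fun l _ hl => by rw [← hl]; rfl, pathSum_finset_sum]
      refine Finset.sum_congr rfl fun m hm => ?_
      have hn : n = (m + 1) + (n - (m + 1)) := by have := Finset.mem_range.mp hm; omega
      rw [pathSum_mul_pathSum]
      conv_lhs => rw [hn]
      rw [pathSum_append]
      refine pathSum_congr fun p _ hp => pathSum_congr fun q _ _ => ?_
      rw [← hp, List.take_left, List.drop_left]
    have h2 : (n.choose (k + 1) : ℝ) = ∑ m ∈ Finset.range n, ((n - (m + 1)).choose k : ℝ) := by
      have h3 := Finset.sum_range_reflect (fun j => (j.choose k : ℝ)) n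
      have h4 : ∑ j ∈ Finset.range n, (j.choose k) = n.choose (k + 1) := by
        clear h1 ih h3
        induction n with
        | zero => simp
        | succ n ih => rw [Finset.sum_range_succ, ih, Nat.choose_succ_succ, add_comm]
      rw [← h4]
      push_cast
      rw [← h3]
      exact Finset.sum_congr rfl fun m _ => by rw [show n - 1 - m = n - (m + 1) by omega]
    rw [h1, h2, Finset.mul_sum, Finset.mul_sum]
    refine Finset.sum_le_sum fun m hm => ?_
    have hn : ((m + 1 : ℕ) : ℝ) + ((n - (m + 1) : ℕ) : ℝ) = n := by
      have := Finset.mem_range.mp hm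
      exact_mod_cast (by omega : (m + 1) + (n - (m + 1)) = n)
    calc _ ≤ (D * Real.exp (F * (m + 1 : ℕ))) * (Real.exp (F * (n - (m + 1) : ℕ)) *
          (D ^ k * (n - (m + 1)).choose k)) :=
          mul_le_mul (hD _) (ih _) (pathSum_nonneg (decompWeight_nonneg _ _) _) (by positivity)
      _ = _ := by
          rw [← hn, mul_add, Real.exp_add]
          ring

/-! ## The upper bound on the free energy of prudent paths -/

theorem take_drop_append (l : List (ℤ × ℤ)) {s t : ℕ} (hst : s ≤ t) :
    l.take s ++ (l.drop s).take (t - s) ++ l.drop t = l := by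
  have : l.drop t = (l.drop s).drop (t - s) := by rw [List.drop_drop]; congr 1; omega
  rw [this, List.append_assoc, List.take_append_drop, List.take_append_drop]

theorem exp_sum_touchCount_le_pieceWeight {β : ℝ} (hβ : 0 ≤ β) {l : List (ℤ × ℤ)}
    (hu : UnitSteps l) (hp : PrudentOn 0 l.length (pathX l) (pathY l)) {K Q s t : ℕ}
    (hK : 0 < K) (hst : s < t) (ht : t ≤ l.length)
    (h : PieceOn (pathX l) (pathY l) l.length Q s t) :
    Real.exp (β * (∑ i ∈ Finset.Ico s t, touchCount (pathX l) (pathY l) 0 i : ℕ)) ≤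
      Real.exp (β * (2 * (8 * K + 1) +
        2 * (mediumSet (pathX l) (pathY l) l.length K Q s t).card : ℕ)) *
      pieceWeight β ((l.drop s).take (t - s)) := by
  set q := (l.drop s).take (t - s) with hq
  have hqlen : q.length = t - s := by simp [hq]; omega
  have htr := translateOn_append (l.take s) q (l.drop t)
  rw [hq, take_drop_append l hst.le, ← hq, List.length_take_of_le (by omega), hqlen] at htr
  have e : s + (t - s) = t := by omega
  rcases h with ⟨hc, hlong⟩ | ⟨a, b, hs⟩
  · have h1 := hp.sum_touchCount_le_of_not_long hK ht hlong
    have h2 : Ham q = ∑ i ∈ Finset.Ico s t, touchCount (pathX l) (pathY l) s i := by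
      rw [Ham_eq_sum, hqlen, htr.sum_touchCount_eq, e]
    have h3 : PrudentOn 0 q.length (pathX q) (pathY q) := by
      rw [hqlen, htr.prudentOn_iff, e]
      exact hp.mono (Nat.zero_le s) ht
    have h4 : ReflCornerOn (pathX q) (pathY q) 0 q.length := by
      rw [hqlen]
      unfold ReflCornerOn at hc ⊢
      rwa [htr.cornerOn_iff, htr.negX.cornerOn_iff, htr.swap.negX.swap.cornerOn_iff,
        htr.negX.swap.negX.swap.cornerOn_iff, e]
    obtain ⟨g, hg⟩ := exists_cor_map h3 h4
    refine le_trans ?_ (mul_le_mul_of_nonneg_left (exp_Ham_le_pieceWeight β hg)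
      (Real.exp_pos _).le)
    rw [← Real.exp_add, ← mul_add, h2]
    refine Real.exp_le_exp.mpr (mul_le_mul_of_nonneg_left ?_ hβ)
    rw [← Nat.cast_add]
    exact_mod_cast h1.trans (le_of_eq (add_comm _ _))
  · have h1 := hp.sum_touchCount_le (s := s) ht
    have hmem : ∀ d ∈ q, d = (a, b) := by
      intro d hd
      obtain ⟨i, hi, rfl⟩ := List.mem_iff_getElem.mp hd
      have hi' : s + i < l.length := by omega
      obtain ⟨h2, h3⟩ := hs (s + i) (by omega) (by omega)
      rw [pathX_succ l hi'] at h2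
      rw [pathY_succ l hi'] at h3
      have h4 : q[i] = l[s + i] := by simp [hq]
      rw [h4]
      exact Prod.ext (by simpa using h2) (by simpa using h3)
    obtain ⟨k, hk⟩ : ∃ k, (a, b) = dirs k := by
      have h0 : 0 < q.length := by omega
      rw [← hmem _ (List.getElem_mem h0)]
      refine hu _ ?_
      exact List.mem_of_mem_drop (List.mem_of_mem_take (List.getElem_mem h0))
    rw [hk] at hmem
    have h2 := exp_length_le_pieceWeight β hmem
    have h3 : Real.exp (β * (∑ i ∈ Finset.Ico s t, touchCount (pathX l) (pathY l) 0 i : ℕ)) ≤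
        Real.exp (2 * β * q.length) := by
      refine Real.exp_le_exp.mpr ?_
      rw [mul_comm 2 β, mul_assoc]
      refine mul_le_mul_of_nonneg_left ?_ hβ
      rw [hqlen]
      exact_mod_cast h1
    refine (h3.trans h2).trans (le_mul_of_one_le_left (pieceWeight_nonneg _ _) ?_)
    exact Real.one_le_exp (mul_nonneg hβ (Nat.cast_nonneg _))

theorem exp_sum_touchCount_le_decompWeight {β : ℝ} (hβ : 0 ≤ β) {l : List (ℤ × ℤ)}
    (hu : UnitSteps l) (hp : PrudentOn 0 l.length (pathX l) (pathY l)) {K Q k s u : ℕ}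
    (hK : 0 < K) (hl : u = l.length)
    (h : Chain (PieceOn (pathX l) (pathY l) l.length Q) k s u) :
    Real.exp (β * (∑ i ∈ Finset.Ico s u, touchCount (pathX l) (pathY l) 0 i : ℕ)) ≤
      Real.exp (β * (2 * ((8 * K + 1) * k) +
        2 * (mediumSet (pathX l) (pathY l) l.length K Q s u).card : ℕ)) *
      decompWeight β k (l.drop s) := by
  induction h with
  | nil s =>
    have : decompWeight β 0 (l.drop s) = 1 := if_pos (by simp [hl])
    rw [this, mul_one, Finset.Ico_self, Finset.sum_empty]
    exact Real.exp_le_exp.mpr (mul_le_mul_of_nonneg_left (by exact_mod_cast Nat.zero_le _) hβ)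
  | @cons k s t u hst hG hch ih =>
    have htu := hch.le
    have h1 := exp_sum_touchCount_le_pieceWeight hβ hu hp hK hst (by omega) hG
    have h2 := le_decompWeight_succ β k (l := l.drop s) (m := t - s) (by omega)
      (by simp; omega)
    rw [List.drop_drop, show s + (t - s) = t by omega] at h2
    rw [← Finset.sum_Ico_consecutive _ hst.le htu, Nat.cast_add, mul_add, Real.exp_add,
      card_mediumSet_add _ _ _ _ _ hst.le htu]
    refine (mul_le_mul h1 (ih hl) (Real.exp_pos _).le (mul_nonneg (Real.exp_pos _).le
      (pieceWeight_nonneg _ _))).trans ?_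
    refine le_trans (le_of_eq ?_) (mul_le_mul_of_nonneg_left h2 (Real.exp_pos _).le)
    rw [mul_mul_mul_comm, ← Real.exp_add, ← mul_add, ← Nat.cast_add]
    congr 4
    ring

theorem Chain.add_le {G : ℕ → ℕ → Prop} {k s u : ℕ} (h : Chain G k s u) : s + k ≤ u := by
  induction h with
  | nil => exact le_rfl
  | cons h1 _ _ ih => omega

/-- The partition function of prudent paths has at most the exponential growth rate of the
partition function of corner pieces. -/
theorem Zpsaw_le {β F : ℝ} (hβ : 0 ≤ β) (hF : ∀ n : ℕ, Zcor β n ≤ Real.exp (F * (n + 2)))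
    {ε : ℝ} (hε : 0 < ε) :
    ∃ B : ℝ, ∀ n : ℕ, Zpsaw β n ≤ Real.exp (B + (F + ε) * n) := by
  have hβF := two_mul_le_of_Zcor_le hβ hF
  have hD := pathSum_pieceWeight_le hF hβF
  set D : ℝ := 8 * Real.exp (2 * F) + 4
  have hD0 : 0 < D := by positivity
  set A : ℝ := |Real.log (D / (ε / 2))| with hA
  obtain ⟨J, hJ⟩ := exists_nat_gt ((4 * β + A) / (ε / 2))
  have hA0 : 0 ≤ A := abs_nonneg _
  have hJ0 : (0 : ℝ) < J := lt_of_le_of_lt (by positivity) hJ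
  rw [div_lt_iff₀ (by positivity)] at hJ
  obtain ⟨C, hC⟩ := exists_good_scale J (by exact_mod_cast hJ0)
  have hDA : D ≤ ε / 2 * Real.exp A := by
    rw [mul_comm, ← div_le_iff₀ (by positivity), ← Real.log_le_iff_le_exp (by positivity)]
    exact le_abs_self _
  refine ⟨(2 * β + A) * C, fun n => ?_⟩
  set E : ℝ := Real.exp ((4 * β + A) * n / J + (2 * β + A) * C) with hE
  have hpoint : ∀ l : List (ℤ × ℤ), UnitSteps l → l.length = n → IsPrudent l →
      Real.exp (β * Ham l) ≤ E *
        ∑ k ∈ Finset.range (n + 1), Real.exp (-A * k) * decompWeight β k l := by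
    intro l hu hn hpr
    have hp := (isPrudent_iff hu).mp hpr
    obtain ⟨K, Q, k, hK, hch, h1, h2⟩ := hC _ _ _ hp
    have h3 := exp_sum_touchCount_le_decompWeight hβ hu hp hK rfl hch
    have hkn := hch.add_le
    rw [← Finset.range_eq_Ico, ← Ham_eq_sum, List.drop_zero] at h3
    refine h3.trans ?_
    have h4 : Real.exp (-A * k) * decompWeight β k l ≤
        ∑ k ∈ Finset.range (n + 1), Real.exp (-A * k) * decompWeight β k l :=
      Finset.single_le_sum (f := fun k : ℕ => Real.exp (-A * k) * decompWeight β k l)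
        (fun k _ => mul_nonneg (Real.exp_pos _).le (decompWeight_nonneg _ _ _))
        (Finset.mem_range.mpr (by omega))
    refine le_trans ?_ (mul_le_mul_of_nonneg_left h4 (Real.exp_pos _).le)
    rw [← mul_assoc E, hE, ← Real.exp_add]
    refine mul_le_mul_of_nonneg_right (Real.exp_le_exp.mpr ?_) (decompWeight_nonneg _ _ _)
    rw [hn] at h1 h2 ⊢
    obtain ⟨P, hP⟩ : ∃ P : ℝ, P = ((8 * K + 1) * k : ℕ) := ⟨_, rfl⟩
    obtain ⟨S, hS⟩ : ∃ S : ℝ, S = (mediumSet (pathX l) (pathY l) n K Q 0 n).card := ⟨_, rfl⟩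
    have hJ1 : (1 : ℝ) ≤ J := by
      have : 0 < J := by exact_mod_cast hJ0
      exact_mod_cast this
    have g1 : P ≤ n / J + C := by
      have : (J : ℝ) * P ≤ n + C := by
        rw [hP]
        exact_mod_cast h1
      have g : P ≤ (n + C) / J := by rw [le_div_iff₀ hJ0]; linarith
      rw [add_div] at g
      have : (C : ℝ) / J ≤ C := div_le_self (Nat.cast_nonneg C) hJ1
      linarith
    have g2 : S ≤ n / J := by
      rw [le_div_iff₀ hJ0]
      have : (J : ℝ) * S ≤ n := by
        rw [hS]
        exact_mod_cast h2
      linarith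
    have g3 : (k : ℝ) ≤ P := by
      rw [hP]
      exact_mod_cast Nat.le_mul_of_pos_left k (by omega)
    have g4 : ((2 * ((8 * K + 1) * k) + 2 * (mediumSet (pathX l) (pathY l) n K Q 0 n).card : ℕ)
        : ℝ) = 2 * P + 2 * S := by
      rw [hP, hS]
      push_cast
      ring
    rw [g4]
    have g5 : β * (2 * P + 2 * S) ≤ β * (2 * (n / J + C) + 2 * (n / J)) :=
      mul_le_mul_of_nonneg_left (by linarith) hβ
    have g6 : A * k ≤ A * (n / J + C) := mul_le_mul_of_nonneg_left (by linarith) hA0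
    have g7 : (4 * β + A) * n / J = (4 * β + A) * (n / J) := by ring
    rw [g7]
    nlinarith
  have hsum : Zpsaw β n ≤ E * ∑ k ∈ Finset.range (n + 1),
      Real.exp (-A * k) * pathSum (decompWeight β k) n := by
    have h1 : E * ∑ k ∈ Finset.range (n + 1), Real.exp (-A * k) * pathSum (decompWeight β k) n =
        pathSum (fun l => E *
          ∑ k ∈ Finset.range (n + 1), Real.exp (-A * k) * decompWeight β k l) n := by
      rw [pathSum_const_mul, pathSum_finset_sum]
      simp only [pathSum_const_mul]
    rw [h1, pathSum_eq, Zpsaw, psawFinset, Finset.sum_filter]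
    refine Finset.sum_le_sum fun s _ => ?_
    split_ifs with h2
    · exact hpoint _ (unitSteps_stepsOf s) (by simp [stepsOf]) h2
    · exact mul_nonneg (Real.exp_pos _).le (Finset.sum_nonneg fun k _ =>
        mul_nonneg (Real.exp_pos _).le (decompWeight_nonneg _ _ _))
  have hbin : ∑ k ∈ Finset.range (n + 1), Real.exp (-A * k) * pathSum (decompWeight β k) n ≤
      Real.exp (F * n) * Real.exp (ε / 2 * n) := by
    calc _ ≤ ∑ k ∈ Finset.range (n + 1),
          Real.exp (F * n) * ((ε / 2) ^ k * 1 ^ (n - k) * n.choose k) := by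
          refine Finset.sum_le_sum fun k _ => ?_
          have h1 : Real.exp (-A * k) * D ^ k ≤ (ε / 2) ^ k := by
            have h2 : D ^ k ≤ (ε / 2 * Real.exp A) ^ k := pow_le_pow_left₀ hD0.le hDA k
            rw [mul_pow, ← Real.exp_nat_mul] at h2
            refine (mul_le_mul_of_nonneg_left h2 (Real.exp_pos _).le).trans (le_of_eq ?_)
            rw [mul_left_comm, ← Real.exp_add, neg_mul, mul_comm A, neg_add_cancel,
              Real.exp_zero, mul_one]
          refine (mul_le_mul_of_nonneg_left (pathSum_decompWeight_le hD0.le hD k n)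
            (Real.exp_pos _).le).trans ?_
          rw [mul_left_comm, one_pow, mul_one, ← mul_assoc (Real.exp (-A * k))]
          exact mul_le_mul_of_nonneg_left
            (mul_le_mul_of_nonneg_right h1 (Nat.cast_nonneg _)) (Real.exp_pos _).le
      _ = Real.exp (F * n) * (ε / 2 + 1) ^ n := by rw [← Finset.mul_sum, ← add_pow]
      _ ≤ Real.exp (F * n) * Real.exp (ε / 2 * n) := by
          refine mul_le_mul_of_nonneg_left ?_ (Real.exp_pos _).le
          rw [mul_comm, Real.exp_nat_mul]
          exact pow_le_pow_left₀ (by positivity) (Real.add_one_le_exp _) n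
  refine (hsum.trans (mul_le_mul_of_nonneg_left hbin (Real.exp_pos _).le)).trans ?_
  rw [hE, ← Real.exp_add, ← Real.exp_add]
  refine Real.exp_le_exp.mpr ?_
  have h1 : (4 * β + A) * n / J ≤ ε / 2 * n := by
    rw [div_le_iff₀ hJ0]
    have := mul_le_mul_of_nonneg_right hJ.le (Nat.cast_nonneg (α := ℝ) n)
    linarith
  linarith

/-- A sequence whose logarithm is squeezed between that of the partition function of corner
pieces and that of prudent paths has the same exponential growth rate. -/
theorem tendsto_log_div_of_Zcor_le {β F : ℝ} (hβ : 0 ≤ β)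
    (hlim : Tendsto (fun n : ℕ => Real.log (Zcor β (n - 2)) / n) atTop (nhds F))
    (hF : ∀ n : ℕ, Zcor β n ≤ Real.exp (F * (n + 2))) {Z : ℕ → ℝ}
    (h1 : ∀ n, Zcor β n ≤ Z n) (h2 : ∀ n, Z n ≤ Zpsaw β n) :
    Tendsto (fun n : ℕ => Real.log (Z n) / n) atTop (nhds F) := by
  have hpos : ∀ n, 0 < Zcor β n := fun n => zero_lt_one.trans_le (one_le_Zcor hβ n)
  refine tendsto_order.mpr ⟨fun a ha => ?_, fun a ha => ?_⟩
  · filter_upwards [(tendsto_order.mp hlim).1 a ha] with n hn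
    refine hn.trans_le (div_le_div_of_nonneg_right ?_ (Nat.cast_nonneg n))
    exact Real.log_le_log (hpos _) ((Zcor_mono hβ (Nat.sub_le n 2)).trans (h1 n))
  · obtain ⟨B, hB⟩ := Zpsaw_le hβ hF (ε := (a - F) / 2) (by linarith)
    obtain ⟨N, hN⟩ := exists_nat_gt (B / ((a - F) / 2))
    rw [div_lt_iff₀ (by linarith)] at hN
    filter_upwards [eventually_ge_atTop N, eventually_gt_atTop 0] with n hn hn0
    have hn0' : (0 : ℝ) < n := by exact_mod_cast hn0
    have hn' : (N : ℝ) ≤ n := by exact_mod_cast hn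
    rw [div_lt_iff₀ hn0']
    have h3 := (h2 n).trans (hB n)
    rw [← Real.log_le_iff_le_exp ((hpos n).trans_le (h1 n))] at h3
    nlinarith

/-- For every `β ≥ 0`, the limits `F(β) = lim (1/L) log Z_{β,L}` and
`F^NE(β) = lim (1/L) log Z^NE_{β,L}` exist, are finite, and are equal. -/
theorem ipsaw_free_energy_exists_and_equals_NE (β : ℝ) (hβ : 0 ≤ β) :
    ∃ F : ℝ,
      Tendsto (fun L : ℕ => Real.log (Zpsaw β L) / (L : ℝ)) atTop (nhds F) ∧
      Tendsto (fun L : ℕ => Real.log (Zne β L) / (L : ℝ)) atTop (nhds F) := by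
  obtain ⟨F, hlim, hF⟩ := exists_free_energy_cor hβ
  exact ⟨F, tendsto_log_div_of_Zcor_le hβ hlim hF
      (fun n => (Zcor_le_Zne β n).trans (Zne_le_Zpsaw β n)) fun n => le_rfl,
    tendsto_log_div_of_Zcor_le hβ hlim hF (Zcor_le_Zne β) (Zne_le_Zpsaw β)⟩
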